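/- arXiv:2004.08429 — 3 statements merged into one kernel-verified Lean document; each statement's English description precedes it below -/
import Mathlib

section
/- The number of k-faces of T^{d,d-a}_m, the (d-a)-fold pyramid over the simplicial polytope T^a_m = T^m ⊕ T^{a-m} (direct sum of simplices), equals C(d+2, d-k+1) - C(d-a+m+1, d-k+1) - C(d-m+1, d-k+1) + C(d-a+1, d-k+1) for all 0 ≤ k ≤ d-1. -/
open Set

/-- `C n m` : binomial coefficient with the convention `C n m = 0` for `n < 0`. -/
def C (n : ℤ) (m : ℕ) : ℤ := if n < 0 then 0 else (n.toNat).choose m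

/-- Grünbaum's lower bound function `φ_k(d+s, d)`. -/
def phi (d s k : ℕ) : ℤ := C (d + 1) (k + 1) + C d (k + 1) - C ((d : ℤ) + 1 - s) (k + 1)

/-- A polytope: convex hull of a finite set of points. -/
def IsPolytope {N : ℕ} (P : Set (EuclideanSpace ℝ (Fin N))) : Prop :=
  ∃ V : Finset (EuclideanSpace ℝ (Fin N)), P = convexHull ℝ (V : Set (EuclideanSpace ℝ (Fin N)))

/-- The dimension of a set: the dimension of its affine span. -/
noncomputable def pdim {N : ℕ} (P : Set (EuclideanSpace ℝ (Fin N))) : ℕ :=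
  Module.finrank ℝ (affineSpan ℝ P).direction

/-- `F` is a face of `P`: the intersection of `P` with a supporting hyperplane
(the linear functional may be zero, so `P` itself is a face; `F` may be empty). -/
def IsFace {N : ℕ} (P F : Set (EuclideanSpace ℝ (Fin N))) : Prop :=
  ∃ (f : EuclideanSpace ℝ (Fin N) →ₗ[ℝ] ℝ) (c : ℝ),
    (∀ x ∈ P, f x ≤ c) ∧ F = {x ∈ P | f x = c}

/-- The set of vertices of `P` (points whose singleton is a face of `P`). -/
def vertexSet {N : ℕ} (P : Set (EuclideanSpace ℝ (Fin N))) : Set (EuclideanSpace ℝ (Fin N)) :=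
  {v | IsFace P {v}}

/-- The number of (nonempty) `k`-dimensional faces of `P`. -/
noncomputable def fCount {N : ℕ} (P : Set (EuclideanSpace ℝ (Fin N))) (k : ℕ) : ℕ :=
  {F : Set (EuclideanSpace ℝ (Fin N)) | IsFace P F ∧ F.Nonempty ∧ pdim F = k}.ncard

/-- `P` is a `k`-dimensional simplex. -/
def IsSimplex {N : ℕ} (P : Set (EuclideanSpace ℝ (Fin N))) (k : ℕ) : Prop :=
  ∃ V : Finset (EuclideanSpace ℝ (Fin N)), V.card = k + 1 ∧
    AffineIndependent ℝ (Subtype.val : {x // x ∈ V} → EuclideanSpace ℝ (Fin N)) ∧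
    P = convexHull ℝ (V : Set (EuclideanSpace ℝ (Fin N)))

/-- `Q` is a pyramid over `P`. -/
def IsPyramid {N : ℕ} (Q P : Set (EuclideanSpace ℝ (Fin N))) : Prop :=
  ∃ x, x ∉ affineSpan ℝ P ∧ Q = convexHull ℝ (insert x P)

/-- `Q` is an `r`-fold pyramid over `P`. -/
def IsFoldPyramid {N : ℕ} : ℕ → Set (EuclideanSpace ℝ (Fin N)) → Set (EuclideanSpace ℝ (Fin N)) → Prop
  | 0, Q, P => Q = P
  | (r + 1), Q, P => ∃ R, IsFoldPyramid r R P ∧ IsPyramid Q R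

/-- `Q` is a bipyramid over `P`: the two apices span a segment whose interior
meets the relative interior of `P`. -/
def IsBipyramid {N : ℕ} (Q P : Set (EuclideanSpace ℝ (Fin N))) : Prop :=
  ∃ x y, x ∉ affineSpan ℝ P ∧ y ∉ affineSpan ℝ P ∧
    (openSegment ℝ x y ∩ intrinsicInterior ℝ P).Nonempty ∧
    Q = convexHull ℝ (P ∪ {x, y})

/-- `Q` is the direct sum (free sum) of `P₁` and `P₂`: their affine spans meet in a single
point that is in the relative interior of each. -/
def IsDirectSum {N : ℕ} (Q P₁ P₂ : Set (EuclideanSpace ℝ (Fin N))) : Prop :=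
  ∃ z, (affineSpan ℝ P₁ : Set (EuclideanSpace ℝ (Fin N))) ∩ (affineSpan ℝ P₂) = {z} ∧
    z ∈ intrinsicInterior ℝ P₁ ∧ z ∈ intrinsicInterior ℝ P₂ ∧
    Q = convexHull ℝ (P₁ ∪ P₂)

/-- Combinatorial equivalence: an inclusion-preserving bijection between face lattices. -/
def CombEquiv {N M : ℕ} (P : Set (EuclideanSpace ℝ (Fin N))) (Q : Set (EuclideanSpace ℝ (Fin M))) : Prop :=
  Nonempty ({F : Set (EuclideanSpace ℝ (Fin N)) // IsFace P F} ≃o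
    {G : Set (EuclideanSpace ℝ (Fin M)) // IsFace Q G})

/-- `P` is combinatorially dual to `Q`: its face lattice is that of `Q` reversed. -/
def DualCombEquiv {N M : ℕ} (P : Set (EuclideanSpace ℝ (Fin N))) (Q : Set (EuclideanSpace ℝ (Fin M))) : Prop :=
  Nonempty ({F : Set (EuclideanSpace ℝ (Fin N)) // IsFace P F} ≃o
    ({G : Set (EuclideanSpace ℝ (Fin M)) // IsFace Q G})ᵒᵈ)

/-- `P` (of dimension `d`) is simplicial: all its facets are simplices. -/
def IsSimplicial {N : ℕ} (P : Set (EuclideanSpace ℝ (Fin N))) (d : ℕ) : Prop :=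
  ∀ F, IsFace P F → F.Nonempty → pdim F = d - 1 → IsSimplex F (d - 1)

section Combinations

variable {ι E : Type*} [Fintype ι] [AddCommGroup E] [Module ℝ E]

theorem mem_convexHull_range_iff {p : ι → E} {x : E} :
    x ∈ convexHull ℝ (range p) ↔
      ∃ w : ι → ℝ, (∀ i, 0 ≤ w i) ∧ ∑ i, w i = 1 ∧ ∑ i, w i • p i = x := by
  classical
  constructor
  · rw [convexHull_range_eq_exists_affineCombination]
    rintro ⟨s, w, h0, h1, rfl⟩
    refine ⟨fun i => if i ∈ s then w i else 0, fun i => ?_, ?_, ?_⟩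
    · dsimp only
      split_ifs with h
      exacts [h0 i h, le_rfl]
    · simpa using h1
    · rw [s.affineCombination_eq_linear_combination p w h1]
      simp [ite_smul]
  · rintro ⟨w, h0, h1, h2⟩
    exact mem_convexHull_of_exists_fintype w p h0 h1 (fun i => mem_range_self i) h2

theorem sum_smul_mem_affineSpan_range {p : ι → E} {w : ι → ℝ} (hw : ∑ i, w i = 1) :
    ∑ i, w i • p i ∈ affineSpan ℝ (range p) := by
  rw [← Finset.affineCombination_eq_linear_combination _ p w hw]
  exact affineCombination_mem_affineSpan hw p

theorem AffineIndependent.eq_of_sum_smul_eq {p : ι → E} (hp : AffineIndependent ℝ p)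
    {v w : ι → ℝ} (h1 : ∑ i, v i = ∑ i, w i) (h2 : ∑ i, v i • p i = ∑ i, w i • p i) : v = w := by
  funext i
  have := hp.eq_zero_of_sum_eq_zero (s := Finset.univ) (w := v - w)
    (by simp [h1]) (by simp [sub_smul, h2]) i (Finset.mem_univ i)
  simpa [sub_eq_zero] using this

end Combinations

section RelativeInterior

variable {E : Type*} [NormedAddCommGroup E] [NormedSpace ℝ E]

theorem exists_pos_add_smul_sub_mem_of_mem_intrinsicInterior {S : Set E} {y z : E}
    (hz : z ∈ intrinsicInterior ℝ S) (hy : y ∈ S) : ∃ ε > (0 : ℝ), z + ε • (z - y) ∈ S := by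
  obtain ⟨z', hz', rfl⟩ := mem_intrinsicInterior.1 hz
  have hmem (t : ℝ) : (z' : E) + t • ((z' : E) - y) ∈ affineSpan ℝ S := by
    have := AffineMap.lineMap_mem (k := ℝ) (-t) z'.2 (subset_affineSpan ℝ S hy)
    convert this using 1
    simp only [AffineMap.lineMap_apply_module']
    module
  let g : ℝ → affineSpan ℝ S := fun t => ⟨(z' : E) + t • ((z' : E) - y), hmem t⟩
  have hg : Continuous g := by
    apply Continuous.subtype_mk
    fun_prop
  have hg0 : g 0 = z' := by ext; simp [g]
  have hev : ∀ᶠ t in nhds (0 : ℝ), g t ∈ ((↑) ⁻¹' S : Set (affineSpan ℝ S)) :=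
    hg.continuousAt.eventually (by rw [hg0]; exact mem_interior_iff_mem_nhds.1 hz')
  obtain ⟨δ, hδ, h⟩ := Metric.eventually_nhds_iff.1 hev
  refine ⟨δ / 2, by positivity, ?_⟩
  exact h (y := δ / 2) (by rw [Real.dist_eq, sub_zero, abs_of_pos (by positivity)]; linarith)

theorem AffineIndependent.exists_pos_weights {ι : Type*} [Fintype ι] {p : ι → E}
    (hp : AffineIndependent ℝ p) {z : E} (hz : z ∈ intrinsicInterior ℝ (convexHull ℝ (range p))) :
    ∃ w : ι → ℝ, (∀ i, 0 < w i) ∧ ∑ i, w i = 1 ∧ ∑ i, w i • p i = z := by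
  classical
  obtain ⟨w, h0, h1, h2⟩ := mem_convexHull_range_iff.1 (intrinsicInterior_subset hz)
  refine ⟨w, fun i => (h0 i).lt_of_ne fun hi => ?_, h1, h2⟩
  obtain ⟨ε, hε, hmem⟩ := exists_pos_add_smul_sub_mem_of_mem_intrinsicInterior hz
    (subset_convexHull ℝ _ (mem_range_self i))
  obtain ⟨v, v0, v1, v2⟩ := mem_convexHull_range_iff.1 hmem
  have hv : v = fun j => (1 + ε) * w j - ε * (Pi.single i 1 : ι → ℝ) j := by
    apply hp.eq_of_sum_smul_eq
    · simp [Finset.sum_sub_distrib, ← Finset.mul_sum, v1, h1]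
    · simp only [sub_smul, Finset.sum_sub_distrib, mul_smul, ← Finset.smul_sum, v2, h2]
      simp [Pi.single_apply]
      module
  have := v0 i
  rw [hv] at this
  simp [← hi] at this
  linarith

end RelativeInterior

/-- The affine dependences of the family `p` are exactly the multiples of `l`. -/
structure IsCircuit {ι E : Type*} [Fintype ι] [AddCommGroup E] [Module ℝ E]
    (p : ι → E) (l : ι → ℝ) : Prop where
  sum_eq_zero : ∑ i, l i = 0
  sum_smul_eq_zero : ∑ i, l i • p i = 0
  exists_eq_smul : ∀ c : ι → ℝ, ∑ i, c i = 0 → ∑ i, c i • p i = 0 → ∃ t : ℝ, c = t • l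

namespace IsCircuit

section Module

variable {ι κ E : Type*} [Fintype ι] [Fintype κ] [AddCommGroup E] [Module ℝ E]

theorem sumElim {p : ι → E} {q : κ → E} (hp : AffineIndependent ℝ p) (hq : AffineIndependent ℝ q)
    {z : E} {u : ι → ℝ} {v : κ → ℝ} (hu : ∑ i, u i = 1) (hv : ∑ j, v j = 1)
    (hup : ∑ i, u i • p i = z) (hvq : ∑ j, v j • q j = z)
    (hz : ∀ x ∈ affineSpan ℝ (range p), x ∈ affineSpan ℝ (range q) → x = z) :
    IsCircuit (Sum.elim p q) (Sum.elim u (-v)) where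
  sum_eq_zero := by simp [hu, hv]
  sum_smul_eq_zero := by simp [hup, hvq]
  exists_eq_smul c hc hcp := by
    simp only [Fintype.sum_sum_type, Sum.elim_inl, Sum.elim_inr] at hc hcp
    set s := ∑ i, c (Sum.inl i) with hs
    have hs' : ∑ j, c (Sum.inr j) = -s := by linarith
    have hw : ∑ i, (u i + (c (Sum.inl i) - s * u i)) = 1 := by
      simp [Finset.sum_add_distrib, Finset.sum_sub_distrib, ← Finset.mul_sum, hu, ← hs]
    have hw' : ∑ j, (v j - (c (Sum.inr j) + s * v j)) = 1 := by
      simp [Finset.sum_add_distrib, Finset.sum_sub_distrib, ← Finset.mul_sum, hv, hs']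
    have hx : ∑ i, (u i + (c (Sum.inl i) - s * u i)) • p i =
        ∑ j, (v j - (c (Sum.inr j) + s * v j)) • q j := by
      simp only [add_smul, sub_smul, mul_smul, Finset.sum_add_distrib, Finset.sum_sub_distrib,
        ← Finset.smul_sum, hup, hvq, eq_neg_of_add_eq_zero_left hcp]
      abel
    have hxz := hz _ (sum_smul_mem_affineSpan_range hw) (hx ▸ sum_smul_mem_affineSpan_range hw')
    have e1 := hp.eq_of_sum_smul_eq (hw.trans hu.symm) (hxz.trans hup.symm)
    have e2 := hq.eq_of_sum_smul_eq (hw'.trans hv.symm) ((hx.symm.trans hxz).trans hvq.symm)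
    refine ⟨s, ?_⟩
    ext (i | j)
    · have := congrFun e1 i
      simp only [Sum.elim_inl, Pi.smul_apply, smul_eq_mul]
      linarith
    · have := congrFun e2 j
      simp only [Sum.elim_inr, Pi.smul_apply, Pi.neg_apply, smul_eq_mul]
      linarith

variable {p : ι → E} {l : ι → ℝ}

theorem optionElim (h : IsCircuit p l) {x : E} (hx : x ∉ affineSpan ℝ (range p)) :
    IsCircuit (fun o : Option ι => o.elim x p) (fun o => o.elim 0 l) where
  sum_eq_zero := by simp [Fintype.sum_option, h.sum_eq_zero]
  sum_smul_eq_zero := by simp [Fintype.sum_option, h.sum_smul_eq_zero]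
  exists_eq_smul c hc hcp := by
    simp only [Fintype.sum_option, Option.elim_none, Option.elim_some] at hc hcp
    have hc0 : c none = 0 := by
      by_contra hne
      apply hx
      have h1 : ∑ i, (-(c none)⁻¹) * c (some i) = 1 := by
        rw [← Finset.mul_sum, eq_neg_of_add_eq_zero_right hc]
        field_simp
      convert sum_smul_mem_affineSpan_range (p := p) h1
      simp only [mul_smul]
      rw [← Finset.smul_sum, eq_neg_of_add_eq_zero_right hcp, smul_neg, neg_smul, neg_neg,
        inv_smul_smul₀ hne]
    obtain ⟨t, ht⟩ := h.exists_eq_smul (fun i => c (some i)) (by simpa [hc0] using hc)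
      (by simpa [hc0] using hcp)
    refine ⟨t, ?_⟩
    ext (_ | i)
    · simp [hc0]
    · exact congrFun ht i

/-- An assignment of values to the points extends to an affine functional as soon as
it is orthogonal to the affine dependence. -/
theorem exists_affine_values (h : IsCircuit p l) {u : ι → ℝ} (hu : ∑ i, l i * u i = 0) :
    ∃ (f : E →ₗ[ℝ] ℝ) (c : ℝ), ∀ i, f (p i) - c = u i := by
  classical
  let A : (ι → ℝ) →ₗ[ℝ] E × ℝ := Fintype.linearCombination ℝ fun i => (p i, (1 : ℝ))
  let U : Module.Dual ℝ (ι → ℝ) := Fintype.linearCombination ℝ u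
  have hU : U ∈ LinearMap.range A.dualMap := by
    rw [LinearMap.range_dualMap_eq_dualAnnihilator_ker, Submodule.mem_dualAnnihilator]
    intro c hc
    have hc' : ∑ i, c i • (p i, (1 : ℝ)) = 0 := by
      simpa [A, Fintype.linearCombination_apply] using hc
    obtain ⟨t, rfl⟩ := h.exists_eq_smul c
      (by simpa [Prod.snd_sum] using congrArg Prod.snd hc')
      (by simpa [Prod.fst_sum] using congrArg Prod.fst hc')
    rw [map_smul]
    simp [U, Fintype.linearCombination_apply, hu]
  obtain ⟨g, hg⟩ := hU
  refine ⟨g ∘ₗ LinearMap.inl ℝ E ℝ, -g (0, 1), fun i => ?_⟩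
  have := LinearMap.congr_fun hg (Pi.single i 1)
  simp only [LinearMap.dualMap_apply, A, U, Fintype.linearCombination_apply_single, one_smul] at this
  rw [← this, LinearMap.comp_apply, LinearMap.inl_apply, sub_neg_eq_add, ← map_add]
  simp

theorem affineIndependent_restrict (h : IsCircuit p l) {I : Finset ι} {i₀ : ι} (hi₀ : i₀ ∉ I)
    (hl : l i₀ ≠ 0) : AffineIndependent ℝ fun i : I => p i := by
  classical
  rw [affineIndependent_iff_of_fintype]
  intro w hw hwp i
  rw [Finset.weightedVSub_eq_linear_combination _ hw] at hwp
  let c : ι → ℝ := fun j => if hj : j ∈ I then w ⟨j, hj⟩ else 0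
  have hcw (j : I) : c j = w j := by simp [c]
  have hc0 (j : ι) (hj : j ∉ I) : c j = 0 := by simp [c, hj]
  obtain ⟨t, ht⟩ := h.exists_eq_smul c
    (by
      rw [← Finset.sum_subset I.subset_univ fun j _ hj => hc0 j hj, ← Finset.sum_coe_sort]
      simpa only [hcw] using hw)
    (by
      rw [← Finset.sum_subset I.subset_univ fun j _ hj => by rw [hc0 j hj, zero_smul],
        ← Finset.sum_coe_sort]
      simpa only [hcw] using hwp)
  have ht0 : t = 0 := by
    have := congrFun ht i₀
    rw [hc0 i₀ hi₀] at this
    simpa [hl] using this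
  rw [← hcw, ht, ht0, zero_smul, Pi.zero_apply]

end Module

section Faces

variable {M : ℕ} {ι : Type*} [Fintype ι] {p : ι → EuclideanSpace ℝ (Fin M)} {l : ι → ℝ}

theorem finrank_add_one_of_ne_zero (h : IsCircuit p l) {I : Finset ι} (hI : I.Nonempty) {i₀ : ι}
    (hi₀ : i₀ ∉ I) (hl : l i₀ ≠ 0) : pdim (convexHull ℝ (p '' I)) + 1 = I.card := by
  have : Nonempty I := hI.to_subtype
  have hr : range (fun i : I => p i) = p '' I := by
    rw [image_eq_range]; rfl
  have := (h.affineIndependent_restrict hi₀ hl).finrank_vectorSpan_add_one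
  rw [hr, Fintype.card_coe] at this
  rw [pdim, affineSpan_convexHull, direction_affineSpan, this]

theorem affineSpan_image_erase [DecidableEq ι] (h : IsCircuit p l) {I : Finset ι}
    (hI : ∀ i, l i ≠ 0 → i ∈ I) {i₀ : ι} (hl : l i₀ ≠ 0) :
    affineSpan ℝ (p '' (I.erase i₀ : Finset ι)) = affineSpan ℝ (p '' I) := by
  refine le_antisymm (affineSpan_mono ℝ (image_mono (I.erase_subset i₀))) ?_
  rw [affineSpan_le]
  rintro _ ⟨i, hi, rfl⟩
  by_cases hii : i = i₀
  · subst hii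
    have hsub : ∀ j ∉ I.erase i, j ≠ i → l j = 0 := fun j hj hji => by
      by_contra hlj
      exact hj (Finset.mem_erase.2 ⟨hji, hI j hlj⟩)
    have hsum {V : Type} [AddCommGroup V] [Module ℝ V] (q : ι → V) (hq : ∑ j, l j • q j = 0) :
        ∑ j : I.erase i, (-(l i)⁻¹ * l j) • q j = q i := by
      have h1 : ∑ j ∈ I.erase i, l j • q j = -(l i • q i) := by
        rw [← Finset.add_sum_erase _ _ (Finset.mem_univ i)] at hq
        rw [← eq_neg_of_add_eq_zero_right hq]
        refine Finset.sum_subset (Finset.erase_subset_erase _ I.subset_univ) fun j hj hjI => ?_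
        rw [hsub j hjI (Finset.ne_of_mem_erase hj), zero_smul]
      rw [Finset.sum_coe_sort (I.erase i) fun j => (-(l i)⁻¹ * l j) • q j]
      simp only [mul_smul]
      rw [← Finset.smul_sum, h1, neg_smul, smul_neg, neg_neg, inv_smul_smul₀ hl]
    have h1 : ∑ j : I.erase i, -(l i)⁻¹ * l j = 1 := by
      simpa using hsum (fun _ => (1 : ℝ)) (by simpa using h.sum_eq_zero)
    have h2 := sum_smul_mem_affineSpan_range (p := fun j : I.erase i => p j) h1
    rw [hsum p h.sum_smul_eq_zero] at h2
    convert h2 using 2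
    rw [image_eq_range]; rfl
  · exact subset_affineSpan ℝ _ ⟨i, by simpa [hii] using hi, rfl⟩

theorem finrank_add_two (h : IsCircuit p l) {I : Finset ι}
    (hI : ∀ i, l i ≠ 0 → i ∈ I) (hpos : ∃ i, 0 < l i) (hneg : ∃ i, l i < 0) :
    pdim (convexHull ℝ (p '' I)) + 2 = I.card := by
  classical
  obtain ⟨i, hi⟩ := hpos
  obtain ⟨j, hj⟩ := hneg
  have hne : (I.erase i).Nonempty :=
    ⟨j, Finset.mem_erase.2 ⟨by rintro rfl; linarith, hI j hj.ne⟩⟩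
  have := h.finrank_add_one_of_ne_zero hne (I.notMem_erase i) hi.ne'
  rw [Finset.card_erase_of_mem (hI i hi.ne'), pdim, affineSpan_convexHull,
    h.affineSpan_image_erase hI hi.ne', ← affineSpan_convexHull, ← pdim] at this
  have := Finset.card_pos.2 ⟨i, hI i hi.ne'⟩
  omega

end Faces

end IsCircuit

/-- The indices in `I` are exactly those of the points lying on some supporting hyperplane. -/
def IsFaceIndexSet {M : ℕ} {ι : Type*} (p : ι → EuclideanSpace ℝ (Fin M)) (I : Finset ι) : Prop :=
  ∃ (f : EuclideanSpace ℝ (Fin M) →ₗ[ℝ] ℝ) (c : ℝ),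
    (∀ i, f (p i) ≤ c) ∧ ∀ i, f (p i) = c ↔ i ∈ I

section FaceIndexSet

variable {M : ℕ} {ι : Type*} [Fintype ι] {p : ι → EuclideanSpace ℝ (Fin M)}

theorem sep_eq_convexHull_image {f : EuclideanSpace ℝ (Fin M) →ₗ[ℝ] ℝ} {c : ℝ} {I : Finset ι}
    (hf : ∀ i, f (p i) ≤ c) (hI : ∀ i, f (p i) = c ↔ i ∈ I) :
    {x ∈ convexHull ℝ (range p) | f x = c} = convexHull ℝ (p '' I) := by
  classical
  apply Subset.antisymm
  · rintro x ⟨hx, hfx⟩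
    obtain ⟨w, h0, h1, rfl⟩ := mem_convexHull_range_iff.1 hx
    have hsum : ∑ i, w i * (c - f (p i)) = 0 := by
      simp only [mul_sub, Finset.sum_sub_distrib, ← Finset.sum_mul, h1]
      simp only [map_sum, map_smul, smul_eq_mul] at hfx
      linarith
    have hw (i : ι) (hi : i ∉ I) : w i = 0 := by
      have := (Finset.sum_eq_zero_iff_of_nonneg
        fun i _ => mul_nonneg (h0 i) (sub_nonneg.2 (hf i))).1 hsum i (Finset.mem_univ i)
      refine (mul_eq_zero.1 this).resolve_right fun hc => hi ((hI i).1 (by linarith))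
    rw [← Finset.sum_subset I.subset_univ fun i _ hi => hw i hi] at h1
    rw [← Finset.sum_subset I.subset_univ fun i _ hi => by rw [hw i hi, zero_smul]]
    exact (convex_convexHull ℝ _).sum_mem (fun i _ => h0 i) h1
      fun i hi => subset_convexHull ℝ _ (mem_image_of_mem p hi)
  · intro x hx
    refine ⟨convexHull_mono (image_subset_range _ _) hx, ?_⟩
    have : convexHull ℝ (p '' I) ⊆ {x | f x = c} :=
      convexHull_min (by rintro _ ⟨i, hi, rfl⟩; exact (hI i).2 hi)
        (convex_hyperplane f.isLinear c)
    exact this hx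

theorem isFace_convexHull_range_iff {F : Set (EuclideanSpace ℝ (Fin M))} :
    IsFace (convexHull ℝ (range p)) F ↔
      ∃ I : Finset ι, IsFaceIndexSet p I ∧ convexHull ℝ (p '' I) = F := by
  classical
  constructor
  · rintro ⟨f, c, hf, rfl⟩
    have hf' (i : ι) := hf (p i) (subset_convexHull ℝ _ (mem_range_self i))
    have hI (i : ι) : f (p i) = c ↔ i ∈ Finset.univ.filter fun i => f (p i) = c := by simp
    exact ⟨_, ⟨f, c, hf', hI⟩, (sep_eq_convexHull_image hf' hI).symm⟩
  · rintro ⟨I, ⟨f, c, hf, hI⟩, rfl⟩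
    refine ⟨f, c, fun x hx => ?_, (sep_eq_convexHull_image hf hI).symm⟩
    have : convexHull ℝ (range p) ⊆ {x | f x ≤ c} :=
      convexHull_min (by rintro _ ⟨i, rfl⟩; exact hf i) (convex_halfSpace_le f.isLinear c)
    exact this hx

theorem IsFaceIndexSet.mem_convexHull_iff {I : Finset ι} (hI : IsFaceIndexSet p I) (i : ι) :
    p i ∈ convexHull ℝ (p '' I) ↔ i ∈ I := by
  obtain ⟨f, c, hf, hI⟩ := hI
  rw [← sep_eq_convexHull_image hf hI, ← hI i]
  exact and_iff_right (subset_convexHull ℝ _ (mem_range_self i))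

theorem injOn_convexHull_image :
    InjOn (fun I : Finset ι => convexHull ℝ (p '' I)) {I | IsFaceIndexSet p I} := by
  intro I hI J hJ hIJ
  ext i
  rw [← hI.mem_convexHull_iff, ← hJ.mem_convexHull_iff]
  exact iff_of_eq (congrArg (p i ∈ ·) hIJ)

end FaceIndexSet

section SignedSum

variable {ι : Type*} [Fintype ι] {l : ι → ℝ}

theorem eq_zero_of_sum_mul_eq_zero {u : ι → ℝ} (hu : ∀ i, 0 ≤ u i) (hlu : ∑ i, l i * u i = 0)
    (hpos : ∀ i, 0 < l i → u i = 0) {i : ι} (hi : l i < 0) : u i = 0 := by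
  have hterm : ∀ j ∈ Finset.univ, l j * u j ≤ 0 := fun j _ => by
    rcases le_or_gt (l j) 0 with h | h
    · exact mul_nonpos_of_nonpos_of_nonneg h (hu j)
    · simp [hpos j h]
  have := (Finset.sum_eq_zero_iff_of_nonpos hterm).1 hlu i (Finset.mem_univ i)
  exact (mul_eq_zero.1 this).resolve_left hi.ne

theorem exists_nonneg_of_signs {I : Finset ι}
    (hI : (∀ i, 0 < l i → i ∈ I) ↔ ∀ i, l i < 0 → i ∈ I) :
    ∃ u : ι → ℝ, (∀ i, 0 ≤ u i) ∧ (∀ i, u i = 0 ↔ i ∈ I) ∧ ∑ i, l i * u i = 0 := by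
  classical
  let v : ι → ℝ := fun i => if i ∈ I then 0 else 1
  have hv (i : ι) : 0 ≤ v i := by dsimp only [v]; split_ifs <;> norm_num
  have hvI (i : ι) : v i = 0 ↔ i ∈ I := by simp [v]
  by_cases h : ∀ i, 0 < l i → i ∈ I
  · refine ⟨v, hv, hvI, Finset.sum_eq_zero fun i _ => ?_⟩
    rcases lt_trichotomy (l i) 0 with hi | hi | hi
    · rw [(hvI i).2 (hI.1 h i hi), mul_zero]
    · rw [hi, zero_mul]
    · rw [(hvI i).2 (h i hi), mul_zero]
  · have h' := h
    rw [hI] at h'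
    push Not at h h'
    obtain ⟨a, ha, haI⟩ := h
    obtain ⟨b, hb, hbI⟩ := h'
    set s := ∑ i, l i * v i with hs
    have hx : 0 ≤ max (-s) 0 / l a := div_nonneg (le_max_right _ _) ha.le
    have hy : 0 ≤ max s 0 / -l b := div_nonneg (le_max_right _ _) (by linarith)
    have hsingle (c : ι) (r : ℝ) (hr : 0 ≤ r) (i : ι) : 0 ≤ (Pi.single c r : ι → ℝ) i := by
      rw [Pi.single_apply]; split_ifs <;> simp [hr]
    refine ⟨fun i => v i + (Pi.single a (max (-s) 0 / l a) : ι → ℝ) i +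
      (Pi.single b (max s 0 / -l b) : ι → ℝ) i, fun i => ?_, fun i => ⟨fun hi => ?_, fun hi => ?_⟩,
      ?_⟩
    · have := hv i
      have := hsingle a _ hx i
      have := hsingle b _ hy i
      positivity
    · have := hv i
      have := hsingle a _ hx i
      have := hsingle b _ hy i
      exact (hvI i).1 (by linarith)
    · have hia : i ≠ a := by rintro rfl; exact haI hi
      have hib : i ≠ b := by rintro rfl; exact hbI hi
      simp [hia, hib, (hvI i).2 hi]
    · simp only [mul_add, Finset.sum_add_distrib, ← hs, Pi.single_apply, mul_ite, mul_zero,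
        Finset.sum_ite_eq', Finset.mem_univ, if_true]
      have e1 : l a * (max (-s) 0 / l a) = max (-s) 0 := mul_div_cancel₀ _ ha.ne'
      have e2 : l b * (max s 0 / -l b) = -max s 0 := by field_simp [hb.ne]
      rw [e1, e2]
      rcases le_total s 0 with h0 | h0
      · rw [max_eq_left (by linarith), max_eq_right h0]; ring
      · rw [max_eq_right (by linarith), max_eq_left h0]; ring

end SignedSum

theorem IsCircuit.isFaceIndexSet_iff {M : ℕ} {ι : Type*} [Fintype ι]
    {p : ι → EuclideanSpace ℝ (Fin M)} {l : ι → ℝ} (h : IsCircuit p l) {I : Finset ι} :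
    IsFaceIndexSet p I ↔ ((∀ i, 0 < l i → i ∈ I) ↔ ∀ i, l i < 0 → i ∈ I) := by
  constructor
  · rintro ⟨f, c, hf, hI⟩
    have hu (i : ι) : 0 ≤ c - f (p i) := sub_nonneg.2 (hf i)
    have huI (i : ι) : c - f (p i) = 0 ↔ i ∈ I := by rw [← hI i, sub_eq_zero, eq_comm]
    have hlu : ∑ i, l i * (c - f (p i)) = 0 := by
      have := congrArg f h.sum_smul_eq_zero
      simp only [map_sum, map_smul, smul_eq_mul, map_zero] at this
      simp [mul_sub, Finset.sum_sub_distrib, ← Finset.sum_mul, h.sum_eq_zero, this]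
    simp only [← huI]
    refine ⟨fun hp i hi => eq_zero_of_sum_mul_eq_zero hu hlu hp hi, fun hn i hi => ?_⟩
    exact eq_zero_of_sum_mul_eq_zero (l := -l) hu (by simp [hlu]) (by simpa using hn) (by simpa)
  · intro hI
    obtain ⟨u, hu, huI, hlu⟩ := exists_nonneg_of_signs hI
    obtain ⟨f, c, hfc⟩ := h.exists_affine_values (u := -u) (by simp [hlu])
    simp only [Pi.neg_apply] at hfc
    refine ⟨f, c, fun i => by linarith [hfc i, hu i], fun i => ?_⟩
    rw [← huI i, ← neg_eq_zero, ← hfc i, sub_eq_zero]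

section Counting

variable {ι : Type*} [Fintype ι] [DecidableEq ι]

theorem card_filter_subset_card_eq (V : Finset ι) {j : ℕ} (hj : j ≤ Fintype.card ι) :
    (Finset.univ.filter fun I : Finset ι => I.card = j ∧ V ⊆ I).card =
      (Fintype.card ι - V.card).choose (Fintype.card ι - j) := by
  rw [← Finset.card_compl, ← Finset.card_powersetCard]
  refine Finset.card_bij' (fun I _ => Iᶜ) (fun I _ => Iᶜ) (fun I hI => ?_) (fun I hI => ?_)
    (fun I _ => compl_compl I) (fun I _ => compl_compl I)
  · obtain ⟨h1, h2⟩ := (Finset.mem_filter.1 hI).2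
    exact Finset.mem_powersetCard.2 ⟨Finset.compl_subset_compl.2 h2, by rw [Finset.card_compl, h1]⟩
  · obtain ⟨h1, h2⟩ := Finset.mem_powersetCard.1 hI
    refine Finset.mem_filter.2 ⟨Finset.mem_univ _, ?_, Finset.subset_compl_comm.1 h1⟩
    rw [Finset.card_compl, h2]
    omega

theorem card_filter_not_and_not {α : Type*} (s : Finset α) (a b : α → Prop) [DecidablePred a]
    [DecidablePred b] :
    ((s.filter fun x => ¬a x ∧ ¬b x).card : ℤ) =
      s.card - (s.filter a).card - (s.filter b).card + (s.filter fun x => a x ∧ b x).card := by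
  rw [Finset.card_eq_sum_ones s]
  simp only [Finset.card_filter]
  push_cast
  rw [← Finset.sum_sub_distrib, ← Finset.sum_sub_distrib, ← Finset.sum_add_distrib]
  refine Finset.sum_congr rfl fun x _ => ?_
  by_cases ha : a x <;> by_cases hb : b x <;> simp [ha, hb]

theorem card_filter_add_card_filter {P N : Finset ι} (hPN : Disjoint P N) {k : ℕ}
    (hk : k + 2 ≤ Fintype.card ι) :
    ((Finset.univ.filter fun I : Finset ι => I.card = k + 1 ∧ ¬P ⊆ I ∧ ¬N ⊆ I).card : ℤ) +
      (Finset.univ.filter fun I : Finset ι => I.card = k + 2 ∧ P ⊆ I ∧ N ⊆ I).card =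
      ((Fintype.card ι).choose (Fintype.card ι - (k + 1)) : ℤ) -
        (Fintype.card ι - P.card).choose (Fintype.card ι - (k + 1)) -
        (Fintype.card ι - N.card).choose (Fintype.card ι - (k + 1)) +
        (Fintype.card ι - (P.card + N.card) + 1).choose (Fintype.card ι - (k + 1)) := by
  have hk1 : k + 1 ≤ Fintype.card ι := by omega
  have h0 := card_filter_subset_card_eq (∅ : Finset ι) hk1
  have hP := card_filter_subset_card_eq P hk1
  have hN := card_filter_subset_card_eq N hk1
  have hU := card_filter_subset_card_eq (P ∪ N) hk1
  have hU' := card_filter_subset_card_eq (P ∪ N) hk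
  simp only [Finset.empty_subset, and_true, Finset.card_empty, Nat.sub_zero] at h0
  simp only [Finset.union_subset_iff, Finset.card_union_of_disjoint hPN] at hU hU'
  have hpascal : (Fintype.card ι - (P.card + N.card) + 1).choose (Fintype.card ι - (k + 1)) =
      (Fintype.card ι - (P.card + N.card)).choose (Fintype.card ι - (k + 2)) +
        (Fintype.card ι - (P.card + N.card)).choose (Fintype.card ι - (k + 1)) := by
    rw [show Fintype.card ι - (k + 1) = Fintype.card ι - (k + 2) + 1 by omega, Nat.choose_succ_succ]
  rw [← Finset.filter_filter, card_filter_not_and_not]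
  simp only [Finset.filter_filter]
  rw [h0, hP, hN, hU, hU', hpascal]
  push_cast
  ring

end Counting

theorem IsCircuit.fCount_convexHull_range {M : ℕ} {ι : Type*} [Fintype ι]
    {p : ι → EuclideanSpace ℝ (Fin M)} {l : ι → ℝ} (h : IsCircuit p l)
    (hpos : ∃ i, 0 < l i) (hneg : ∃ i, l i < 0) {k : ℕ} (hk : k + 2 ≤ Fintype.card ι) :
    (fCount (convexHull ℝ (range p)) k : ℤ) =
      ((Fintype.card ι).choose (Fintype.card ι - (k + 1)) : ℤ) -
        (Fintype.card ι - (Finset.univ.filter fun i => 0 < l i).card).choose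
          (Fintype.card ι - (k + 1)) -
        (Fintype.card ι - (Finset.univ.filter fun i => l i < 0).card).choose
          (Fintype.card ι - (k + 1)) +
        (Fintype.card ι - ((Finset.univ.filter fun i => 0 < l i).card +
          (Finset.univ.filter fun i => l i < 0).card) + 1).choose (Fintype.card ι - (k + 1)) := by
  classical
  set P := Finset.univ.filter fun i => 0 < l i with hP
  set N := Finset.univ.filter fun i => l i < 0 with hN
  have hPN : Disjoint P N := Finset.disjoint_filter.2 fun i _ h1 h2 => lt_asymm h1 h2
  have hPI (I : Finset ι) : P ⊆ I ↔ ∀ i, 0 < l i → i ∈ I := by simp [hP, Finset.subset_iff]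
  have hNI (I : Finset ι) : N ⊆ I ↔ ∀ i, l i < 0 → i ∈ I := by simp [hN, Finset.subset_iff]
  rw [← card_filter_add_card_filter hPN hk, ← Nat.cast_add, Nat.cast_inj,
    ← Finset.card_union_of_disjoint
      (Finset.disjoint_filter.2 fun I _ h1 h2 => h1.2.1 h2.2.1),
    ← Set.ncard_coe_finset, fCount]
  have hface (I : Finset ι) : IsFaceIndexSet p I ↔ (P ⊆ I ↔ N ⊆ I) := by
    rw [h.isFaceIndexSet_iff, hPI, hNI]
  rw [← ((injOn_convexHull_image (p := p)).mono _).ncard_image]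
  · congr 1
    ext F
    simp only [mem_ofPred_eq, isFace_convexHull_range_iff, mem_image, Finset.coe_union,
      Finset.coe_filter, mem_union, Finset.mem_univ, true_and]
    have hdim (I : Finset ι) (hne : I.Nonempty) (hI : P ⊆ I ↔ N ⊆ I) :
        pdim (convexHull ℝ (p '' I)) = k ↔
          (I.card = k + 1 ∧ ¬P ⊆ I ∧ ¬N ⊆ I) ∨ (I.card = k + 2 ∧ P ⊆ I ∧ N ⊆ I) := by
      by_cases hPI' : P ⊆ I
      · have hNI' := hI.1 hPI'
        have := h.finrank_add_two (I := I) (fun i hi => by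
          rcases hi.lt_or_gt with hi | hi
          exacts [(hNI I).1 hNI' i hi, (hPI I).1 hPI' i hi]) hpos hneg
        simp only [hPI', hNI', not_true, and_false, false_or, and_true, and_self]
        omega
      · have hNI' := mt hI.2 hPI'
        obtain ⟨i, hi⟩ := not_forall.1 (mt (hPI I).2 hPI')
        have := h.finrank_add_one_of_ne_zero hne (i₀ := i) (by tauto) (by
          rintro h0; simp [h0] at hi)
        simp only [hPI', hNI', not_false_eq_true, and_false, or_false, and_true, and_self]
        omega
    constructor
    · rintro ⟨⟨I, hI, rfl⟩, hne, hk'⟩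
      have hne' : I.Nonempty := by simpa using hne
      exact ⟨I, (hdim I hne' ((hface I).1 hI)).1 hk', rfl⟩
    · rintro ⟨I, hI, rfl⟩
      have hI' : P ⊆ I ↔ N ⊆ I := by tauto
      have hne : I.Nonempty := Finset.card_pos.1 (by omega)
      exact ⟨⟨I, (hface I).2 hI', rfl⟩, by simpa using hne, (hdim I hne hI').2 hI⟩
  · intro I hI
    simp only [Finset.coe_union, Finset.coe_filter, mem_union, Finset.mem_univ, true_and,
      mem_ofPred_eq] at hI
    exact (hface I).2 (by tauto)

theorem IsFoldPyramid.exists_isCircuit {M : ℕ} {T : Set (EuclideanSpace ℝ (Fin M))} {ι : Type}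
    [Fintype ι] {p : ι → EuclideanSpace ℝ (Fin M)} {l : ι → ℝ} (h : IsCircuit p l)
    (hT : T = convexHull ℝ (range p)) {r : ℕ} {Q : Set (EuclideanSpace ℝ (Fin M))}
    (hQ : IsFoldPyramid r Q T) :
    ∃ (κ : Type) (_ : Fintype κ) (q : κ → EuclideanSpace ℝ (Fin M)) (l' : κ → ℝ),
      IsCircuit q l' ∧ Q = convexHull ℝ (range q) ∧ Fintype.card κ = Fintype.card ι + r ∧
      (Finset.univ.filter fun i => 0 < l' i).card = (Finset.univ.filter fun i => 0 < l i).card ∧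
      (Finset.univ.filter fun i => l' i < 0).card = (Finset.univ.filter fun i => l i < 0).card := by
  induction r generalizing Q with
  | zero => exact ⟨ι, _, p, l, h, hQ.trans hT, rfl, rfl, rfl⟩
  | succ r ih =>
    obtain ⟨R, hR, x, hx, rfl⟩ := hQ
    obtain ⟨κ, _, q, l', hq, rfl, hcard, hpos, hneg⟩ := ih hR
    rw [affineSpan_convexHull] at hx
    refine ⟨Option κ, inferInstance, _, _, hq.optionElim hx, ?_, ?_, ?_, ?_⟩
    · have hrange : range (fun o : Option κ => o.elim x q) = insert x (range q) := by
        ext y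
        simp [Option.exists, eq_comm]
      rw [hrange, insert_eq, convexHull_convexHull_union_right, ← insert_eq]
    · rw [Fintype.card_option, hcard, add_assoc]
    · rw [← hpos]
      rw [Finset.card_filter, Finset.card_filter, Fintype.sum_option]
      simp only [Option.elim_none, Option.elim_some, lt_irrefl, if_false, zero_add]
      congr!
    · rw [← hneg]
      rw [Finset.card_filter, Finset.card_filter, Fintype.sum_option]
      simp only [Option.elim_none, Option.elim_some, lt_irrefl, if_false, zero_add]
      congr!

theorem stmt11 {M : ℕ} (S₁ S₂ T Q : Set (EuclideanSpace ℝ (Fin M))) (d a m k : ℕ)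
    (hm1 : 1 ≤ m) (hm2 : m ≤ a - 1) (had : a ≤ d) (hk : k ≤ d - 1)
    (hS₁ : IsSimplex S₁ m) (hS₂ : IsSimplex S₂ (a - m))
    (hT : IsDirectSum T S₁ S₂) (hQ : IsFoldPyramid (d - a) Q T) :
    (fCount Q k : ℤ) =
      ((d + 2).choose (d - k + 1) : ℤ) - ((d - a + m + 1).choose (d - k + 1) : ℤ)
        - ((d - m + 1).choose (d - k + 1) : ℤ) + ((d - a + 1).choose (d - k + 1) : ℤ) := by
  obtain ⟨V₁, hV₁, hi₁, rfl⟩ := hS₁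
  obtain ⟨V₂, hV₂, hi₂, rfl⟩ := hS₂
  obtain ⟨z, hz, hz₁, hz₂, rfl⟩ := hT
  rw [affineSpan_convexHull, affineSpan_convexHull] at hz
  have hr₁ : range (Subtype.val : {x // x ∈ V₁} → EuclideanSpace ℝ (Fin M)) = V₁ :=
    Subtype.range_coe
  have hr₂ : range (Subtype.val : {x // x ∈ V₂} → EuclideanSpace ℝ (Fin M)) = V₂ :=
    Subtype.range_coe
  rw [← hr₁] at hz hz₁ hQ
  rw [← hr₂] at hz hz₂ hQ
  obtain ⟨u, hu, hu1, huz⟩ := hi₁.exists_pos_weights hz₁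
  obtain ⟨v, hv, hv1, hvz⟩ := hi₂.exists_pos_weights hz₂
  have hcirc := IsCircuit.sumElim hi₁ hi₂ hu1 hv1 huz hvz
    fun x hx₁ hx₂ => (Set.ext_iff.1 hz x).1 ⟨hx₁, hx₂⟩
  obtain ⟨κ, _, q, l, hq, rfl, hcard, hpos, hneg⟩ := IsFoldPyramid.exists_isCircuit hcirc
    (by rw [Sum.elim_range, convexHull_convexHull_union_left, convexHull_convexHull_union_right]) hQ
  have hpos' : (Finset.univ.filter fun i => 0 < l i).card = m + 1 := by
    rw [hpos, ← hV₁]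
    rw [Finset.card_filter, Fintype.sum_sum_type]
    simp [hu, fun i => (hv i).le]
  have hneg' : (Finset.univ.filter fun i => l i < 0).card = a - m + 1 := by
    rw [hneg, ← hV₂]
    rw [Finset.card_filter, Fintype.sum_sum_type]
    simp [hv, fun i => (hu i).not_gt, -Subtype.forall]
  have hcard' : Fintype.card κ = d + 2 := by
    rw [hcard, Fintype.card_sum, Fintype.card_coe, Fintype.card_coe, hV₁, hV₂]
    omega
  have hexists {P : κ → Prop} [DecidablePred P] (hP : 0 < (Finset.univ.filter P).card) :
      ∃ i, P i := by
    obtain ⟨i, hi⟩ := Finset.card_pos.1 hP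
    exact ⟨i, (Finset.mem_filter.1 hi).2⟩
  rw [hq.fCount_convexHull_range (hexists (by omega)) (hexists (by omega)) (by omega), hpos', hneg',
    hcard', show d + 2 - (k + 1) = d - k + 1 by omega, show d + 2 - (m + 1) = d - m + 1 by omega,
    show d + 2 - (a - m + 1) = d - a + m + 1 by omega,
    show d + 2 - (m + 1 + (a - m + 1)) + 1 = d - a + 1 by omega]
  ring
end

section
/- Barnette's facet count bound: every simplicial d-polytope with at least d+2 vertices has at least 2d facets. -/
open Set

section FacetCounting

variable {α : Type*} [DecidableEq α]

/-- A set of the same size as `F`, containing `F \ {v}` but not `v`, is obtained from `F` by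
exchanging `v` for some element outside `F`. -/
lemma exists_eq_insert_erase {F G : Finset α} {v : α} (hcard : G.card = F.card) (hv : v ∈ F)
    (hvG : v ∉ G) (hsub : F.erase v ⊆ G) : ∃ w, w ∉ F ∧ G = insert w (F.erase v) := by
  have hpos : 0 < F.card := Finset.card_pos.2 ⟨v, hv⟩
  have hc : (G \ F.erase v).card = 1 := by
    rw [Finset.card_sdiff_of_subset hsub, Finset.card_erase_of_mem hv]
    omega
  obtain ⟨w, hw⟩ := Finset.card_eq_one.1 hc
  have hwm : w ∈ G \ F.erase v := by simp [hw]
  rw [Finset.mem_sdiff] at hwm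
  refine ⟨w, fun hwF => hwm.2 (Finset.mem_erase.2 ⟨?_, hwF⟩), ?_⟩
  · rintro rfl
    exact hvG hwm.1
  · rw [← Finset.sdiff_union_of_subset hsub, hw]
    rfl

/-- A family of `d`-sets in which every ridge of a member lies in another member, and in which
some exchange `w` is possible at some but not all elements of a member `F`, has at least `2 * d`
members. -/
lemma two_mul_le_card_of_partial_exchange {d : ℕ} {𝓕 : Finset (Finset α)}
    (hcard : ∀ F ∈ 𝓕, F.card = d)
    (hridge : ∀ F ∈ 𝓕, ∀ v ∈ F, ∃ G ∈ 𝓕, v ∉ G ∧ F.erase v ⊆ G)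
    {F : Finset α} (hF : F ∈ 𝓕) {w i₀ j₀ : α} (hw : w ∉ F) (hi₀ : i₀ ∈ F) (hj₀ : j₀ ∈ F)
    (hi : insert w (F.erase i₀) ∈ 𝓕) (hj : insert w (F.erase j₀) ∉ 𝓕) : 2 * d ≤ 𝓕.card := by
  set I := F.filter fun v => insert w (F.erase v) ∈ 𝓕 with hI
  set J := F.filter fun v => ¬ insert w (F.erase v) ∈ 𝓕 with hJ
  have hIJ : I.card + J.card = d := by
    rw [← hcard F hF]
    exact Finset.card_filter_add_card_filter_not _
  have hIpos : 0 < I.card := Finset.card_pos.2 ⟨i₀, by simp [hI, hi₀, hi]⟩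
  have hJpos : 0 < J.card := Finset.card_pos.2 ⟨j₀, by simp [hJ, hj₀, hj]⟩
  set A : Finset (Finset α) := {∅}
  set B : Finset (Finset α) := F.image fun v => {v}
  set D : Finset (Finset α) := (I ×ˢ J).image fun p => {p.1, p.2}
  have hB : B.card = d := by
    rw [← hcard F hF]
    exact Finset.card_image_of_injective _ Finset.singleton_injective
  have hD : D.card = I.card * J.card := by
    rw [← Finset.card_product]
    refine Finset.card_image_of_injOn ?_
    rintro ⟨a, b⟩ hab ⟨a', b'⟩ hab' h
    simp only [Finset.coe_product, Set.mem_prod, Finset.mem_coe, hI, hJ, Finset.mem_filter]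
      at hab hab'
    have h1 : a ∈ ({a', b'} : Finset α) := by
      have : a ∈ ({a, b} : Finset α) := by simp
      simpa only [← h] using this
    have h2 : b ∈ ({a', b'} : Finset α) := by
      have : b ∈ ({a, b} : Finset α) := by simp
      simpa only [← h] using this
    simp only [Finset.mem_insert, Finset.mem_singleton] at h1 h2
    grind
  have hdAB : Disjoint A B := by
    simp [A, B]
  have hcardD : ∀ X ∈ D, X.card = 2 := by
    intro X hX
    simp only [D, Finset.mem_image, Finset.mem_product, Prod.exists, hI, hJ,
      Finset.mem_filter] at hX
    obtain ⟨a, b, hab, rfl⟩ := hX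
    refine Finset.card_pair ?_
    rintro rfl
    exact hab.2.2 hab.1.2
  have hdABD : Disjoint (A ∪ B) D := by
    rw [Finset.disjoint_left]
    intro X hX hXD
    have := hcardD X hXD
    simp only [A, B, Finset.mem_union, Finset.mem_singleton, Finset.mem_image] at hX
    rcases hX with rfl | ⟨v, -, rfl⟩ <;> simp at this
  have hsub : (A ∪ B) ∪ D ⊆ 𝓕.image fun X => F \ X := by
    intro X hX
    simp only [A, B, D, Finset.mem_union, Finset.mem_singleton, Finset.mem_image,
      Finset.mem_product, Prod.exists] at hX
    rw [Finset.mem_image]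
    rcases hX with (rfl | ⟨v, hv, rfl⟩) | ⟨a, b, ⟨ha, hb⟩, rfl⟩
    · exact ⟨F, hF, by simp⟩
    · obtain ⟨G, hG, hvG, hGs⟩ := hridge F hF v hv
      refine ⟨G, hG, ?_⟩
      grind
    · simp only [hI, hJ, Finset.mem_filter] at ha hb
      have hab : a ≠ b := by
        rintro rfl
        exact hb.2 ha.2
      obtain ⟨H, hH, hbH, hHs⟩ := hridge _ ha.2 b (by grind)
      refine ⟨H, hH, ?_⟩
      have haH : a ∉ H := by
        intro haH
        refine hb.2 ?_
        have hle : insert w (F.erase b) ⊆ H := by grind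
        have : insert w (F.erase b) = H := by
          refine Finset.eq_of_subset_of_card_le hle ?_
          rw [hcard H hH, Finset.card_insert_of_notMem (by grind),
            Finset.card_erase_of_mem hb.1, hcard F hF]
          omega
        rwa [this]
      have hmem : ∀ x ∈ F, x ≠ a → x ≠ b → x ∈ H := fun x hx hxa hxb =>
        hHs (by simp [hx, hxa, hxb])
      ext x
      simp only [Finset.mem_sdiff, Finset.mem_insert, Finset.mem_singleton]
      constructor
      · rintro ⟨hx, hxH⟩
        by_contra! hne
        exact hxH (hmem x hx hne.1 hne.2)
      · rintro (rfl | rfl)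
        exacts [⟨ha.1, haH⟩, ⟨hb.1, hbH⟩]
  have hle := (Finset.card_le_card hsub).trans Finset.card_image_le
  rw [Finset.card_union_of_disjoint hdABD, Finset.card_union_of_disjoint hdAB, hB, hD] at hle
  have hA : A.card = 1 := Finset.card_singleton _
  nlinarith

/-- A family of `d`-sets in which every ridge of a member lies in another member, and whose
members cover at least `d + 2` points, has at least `2 * d` members. -/
theorem two_mul_le_card_of_ridges {d : ℕ} (hd : 1 ≤ d) {𝓕 : Finset (Finset α)}
    (hcard : ∀ F ∈ 𝓕, F.card = d)
    (hridge : ∀ F ∈ 𝓕, ∀ v ∈ F, ∃ G ∈ 𝓕, v ∉ G ∧ F.erase v ⊆ G)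
    {U : Finset α} (hU : d + 2 ≤ U.card) (hcover : ∀ e ∈ U, ∃ F ∈ 𝓕, e ∈ F) :
    2 * d ≤ 𝓕.card := by
  by_cases hex : ∃ F ∈ 𝓕, ∃ w ∉ F, ∃ i ∈ F, ∃ j ∈ F,
      insert w (F.erase i) ∈ 𝓕 ∧ insert w (F.erase j) ∉ 𝓕
  · obtain ⟨F, hF, w, hw, i, hi, j, hj, h1, h2⟩ := hex
    exact two_mul_le_card_of_partial_exchange hcard hridge hF hw hi hj h1 h2
  push Not at hex
  have hfull : ∀ F ∈ 𝓕, ∃ S, F ⊆ S ∧ S.card = d + 1 ∧ S.powersetCard d ⊆ 𝓕 := by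
    intro F hF
    obtain ⟨v, hv⟩ : F.Nonempty := Finset.card_pos.1 (by rw [hcard F hF]; omega)
    obtain ⟨G, hG, hvG, hs⟩ := hridge F hF v hv
    obtain ⟨w, hw, rfl⟩ :=
      exists_eq_insert_erase ((hcard G hG).trans (hcard F hF).symm) hv hvG hs
    refine ⟨insert w F, Finset.subset_insert _ _, ?_, ?_⟩
    · rw [Finset.card_insert_of_notMem hw, hcard F hF]
    · intro X hX
      rw [Finset.mem_powersetCard] at hX
      have hc : (insert w F \ X).card = 1 := by
        rw [Finset.card_sdiff_of_subset hX.1, Finset.card_insert_of_notMem hw, hcard F hF]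
        omega
      obtain ⟨x, hx⟩ := Finset.card_eq_one.1 hc
      have hXe : X = (insert w F).erase x := by
        rw [Finset.erase_eq, ← hx, Finset.sdiff_sdiff_eq_self hX.1]
      by_cases hxw : x = w
      · rw [hXe, hxw, Finset.erase_insert hw]
        exact hF
      · have hxF : x ∈ F := by
          have : x ∈ insert w F \ X := by simp [hx]
          grind
        rw [hXe, Finset.erase_insert_of_ne (Ne.symm hxw)]
        exact hex F hF w hw v hv x hxF hG
  obtain ⟨e₀, he₀⟩ : U.Nonempty := Finset.card_pos.1 (by omega)
  obtain ⟨F, hF, -⟩ := hcover e₀ he₀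
  obtain ⟨S, -, hSc, hS⟩ := hfull F hF
  obtain ⟨e, heU, heS⟩ := Finset.exists_mem_notMem_of_card_lt_card (s := S) (t := U) (by omega)
  obtain ⟨F', hF', heF'⟩ := hcover e heU
  obtain ⟨S', hFS', hSc', hS'⟩ := hfull F' hF'
  have hint : (S.powersetCard d ∩ S'.powersetCard d).card ≤ 1 := by
    have hsub : S.powersetCard d ∩ S'.powersetCard d ⊆ (S' ∩ S).powersetCard d := by
      intro X
      simp only [Finset.mem_inter, Finset.mem_powersetCard]
      exact fun h => ⟨Finset.subset_inter h.2.1 h.1.1, h.1.2⟩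
    have hlt : (S' ∩ S).card < S'.card := by
      refine Finset.card_lt_card (Finset.ssubset_iff_subset_ne.2 ⟨Finset.inter_subset_left, ?_⟩)
      intro h
      exact heS (Finset.inter_eq_left.1 h (hFS' heF'))
    refine (Finset.card_le_card hsub).trans ?_
    rw [Finset.card_powersetCard]
    calc (S' ∩ S).card.choose d ≤ d.choose d := Nat.choose_le_choose d (by omega)
      _ = 1 := Nat.choose_self d
  have hun := Finset.card_le_card (Finset.union_subset hS hS')
  have := Finset.card_union_add_card_inter (S.powersetCard d) (S'.powersetCard d)
  simp only [Finset.card_powersetCard, hSc, hSc', Nat.choose_succ_self_right] at this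
  omega

end FacetCounting

section Polytope

variable {N : ℕ}

local notation "𝔼" => EuclideanSpace ℝ (Fin N)

lemma isFace_of_affineMap {P : Set 𝔼} (h : 𝔼 →ᵃ[ℝ] ℝ) (hP : ∀ x ∈ P, h x ≤ 0) :
    IsFace P {x ∈ P | h x = 0} := by
  have hdec : ∀ x, h x = h.linear x + h 0 := fun x => congrFun h.decomp x
  refine ⟨h.linear, -h 0, fun x hx => ?_, ?_⟩
  · linarith [hP x hx, hdec x]
  · ext x
    simp only [Set.mem_ofPred_eq, hdec x, eq_neg_iff_add_eq_zero]

lemma IsFace.exists_affineMap {P F : Set 𝔼} (hF : IsFace P F) :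
    ∃ h : 𝔼 →ᵃ[ℝ] ℝ, (∀ x ∈ P, h x ≤ 0) ∧ F = {x ∈ P | h x = 0} := by
  obtain ⟨f, c, hle, rfl⟩ := hF
  refine ⟨f.toAffineMap - AffineMap.const ℝ 𝔼 c, fun x hx => ?_, ?_⟩
  · simpa using hle x hx
  · ext x
    simp [sub_eq_zero]

lemma IsFace.isExtreme {P F : Set 𝔼} (hF : IsFace P F) : IsExtreme ℝ P F := by
  obtain ⟨f, c, hle, rfl⟩ := hF
  refine ⟨fun x hx => hx.1, ?_⟩
  rintro x hx y hy z hz ⟨a, b, ha, hb, hab, rfl⟩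
  refine ⟨hx, ?_⟩
  have hz2 := hz.2
  simp only [map_add, map_smul, smul_eq_mul] at hz2
  have h1 := hle x hx
  have h2 := hle y hy
  have hb' : b = 1 - a := by linarith
  subst hb'
  nlinarith [mul_nonneg hb.le (sub_nonneg.2 h2), mul_pos ha ha]

/-- A polytope is the convex hull of its finitely many extreme points. -/
lemma IsPolytope.exists_extremePoints {P : Set 𝔼} (hP : IsPolytope P) :
    ∃ E : Finset 𝔼, (E : Set 𝔼) = P.extremePoints ℝ ∧ P = convexHull ℝ (E : Set 𝔼) := by
  obtain ⟨V, rfl⟩ := hP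
  have hfin : ((convexHull ℝ (V : Set 𝔼)).extremePoints ℝ).Finite :=
    V.finite_toSet.subset extremePoints_convexHull_subset
  refine ⟨hfin.toFinset, hfin.coe_toFinset, ?_⟩
  rw [hfin.coe_toFinset, ← (hfin.isClosed_convexHull ℝ).closure_eq]
  exact (closure_convexHull_extremePoints (V.finite_toSet.isCompact_convexHull ℝ)
    (convex_convexHull ℝ _)).symm

lemma vertexSet_subset_extremePoints (P : Set 𝔼) : vertexSet P ⊆ P.extremePoints ℝ :=
  fun _ hv => isExtreme_singleton.1 (IsFace.isExtreme hv)

lemma affineMap_nonpos_of_convexHull {s : Set 𝔼} {h : 𝔼 →ᵃ[ℝ] ℝ} (hs : ∀ x ∈ s, h x ≤ 0) :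
    ∀ x ∈ convexHull ℝ s, h x ≤ 0 := by
  have hc : Convex ℝ {x | h x ≤ 0} := (convex_Iic (0 : ℝ)).affine_preimage h
  exact fun x hx => convexHull_min hs hc hx

/-- The extreme points of `P` lying in a face that is a simplex of the correct dimension are
exactly the vertices of that simplex. -/
lemma IsFace.extremePoints_of_isSimplex {P F : Set 𝔼} {E : Finset 𝔼} {k : ℕ}
    (hE : (E : Set 𝔼) = P.extremePoints ℝ) (hF : IsFace P F) (hS : IsSimplex F k)
    (hk : pdim F = k) {Z : Finset 𝔼} (hZ : ∀ x, x ∈ Z ↔ x ∈ E ∧ x ∈ F) :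
    Z.card = k + 1 ∧ AffineIndependent ℝ (Subtype.val : {x // x ∈ Z} → 𝔼) ∧
      F = convexHull ℝ (Z : Set 𝔼) := by
  obtain ⟨W, hWc, hWi, rfl⟩ := hS
  obtain ⟨Z', hZ', hconv⟩ := IsPolytope.exists_extremePoints ⟨W, rfl⟩
  have hZZ' : Z = Z' := by
    rw [← Finset.coe_inj, hZ', hF.isExtreme.extremePoints_eq, ← hE]
    ext x
    simp only [Finset.mem_coe, hZ, Set.mem_inter_iff, and_comm]
  subst hZZ'
  have hZW : Z ⊆ W := by
    rw [← Finset.coe_subset, hZ']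
    exact extremePoints_convexHull_subset
  have hle : k + 1 ≤ Z.card := by
    rw [hconv, pdim, affineSpan_convexHull, direction_affineSpan] at hk
    have hne : Z.Nonempty := by
      rw [Finset.nonempty_iff_ne_empty]
      rintro rfl
      rw [Finset.coe_empty, convexHull_empty, convexHull_eq_empty, Finset.coe_eq_empty] at hconv
      simp [hconv] at hWc
    have := finrank_vectorSpan_image_finset_le ℝ (id : 𝔼 → 𝔼) Z (n := Z.card - 1)
      (by have := hne.card_pos; omega)
    rw [Finset.image_id, hk] at this
    have := hne.card_pos
    omega
  obtain rfl : Z = W := Finset.eq_of_subset_of_card_le hZW (by omega)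
  exact ⟨hWc, hWi, rfl⟩

/-- A point outside an affine subspace is separated from it by an affine functional. -/
lemma exists_affineMap_eq_zero_eq_one {S : AffineSubspace ℝ 𝔼} {v : 𝔼} (hv : v ∉ S) :
    ∃ g : 𝔼 →ᵃ[ℝ] ℝ, (∀ x ∈ S, g x = 0) ∧ g v = 1 := by
  rcases (S : Set 𝔼).eq_empty_or_nonempty with hS | ⟨p, hp⟩
  · refine ⟨AffineMap.const ℝ 𝔼 1, fun x hx => ?_, rfl⟩
    exact absurd (show x ∈ (S : Set 𝔼) from hx) (by simp [hS])
  have hvp : v - p ∉ S.direction := fun h =>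
    hv (by simpa using AffineSubspace.vadd_mem_of_mem_direction h hp)
  obtain ⟨φ, hφv, hφ⟩ := Submodule.exists_le_ker_of_notMem hvp
  refine ⟨(φ (v - p))⁻¹ • (φ.toAffineMap - AffineMap.const ℝ 𝔼 (φ p)), fun x hx => ?_, ?_⟩
  · have : φ (x - p) = 0 := hφ (AffineSubspace.vsub_mem_direction hx hp)
    rw [map_sub] at this
    simp [this]
  · simp only [AffineMap.coe_smul, AffineMap.coe_sub, Pi.smul_apply, Pi.sub_apply,
      LinearMap.coe_toAffineMap, AffineMap.const_apply, smul_eq_mul]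
    rw [← map_sub]
    exact inv_mul_cancel₀ hφv

/-- Every proper valid affine functional of a polytope is dominated by one defining a facet:
the vertices on the hyperplane stay on it, and a chosen vertex off it stays off it. -/
lemma exists_facet_of_affineMap {P : Set 𝔼} {E : Finset 𝔼} {d : ℕ}
    (hP : P = convexHull ℝ (E : Set 𝔼)) (hdim : pdim P = d) (hd : 1 ≤ d)
    (h₀ : 𝔼 →ᵃ[ℝ] ℝ) (hh₀ : ∀ x ∈ E, h₀ x ≤ 0) {v : 𝔼} (hv : v ∈ E) (hv₀ : h₀ v < 0) :
    ∃ F, IsFace P F ∧ F.Nonempty ∧ pdim F = d - 1 ∧ v ∉ F ∧ ∀ x ∈ E, h₀ x = 0 → x ∈ F := by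
  classical
  have hEP : ∀ x ∈ E, x ∈ P := fun x hx => hP ▸ subset_convexHull ℝ _ hx
  -- Among the admissible functionals take one with the most vertices on its hyperplane.
  let Adm : (𝔼 →ᵃ[ℝ] ℝ) → Prop := fun h =>
    (∀ x ∈ E, h x ≤ 0) ∧ h v < 0 ∧ ∀ x ∈ E, h₀ x = 0 → h x = 0
  let n : (𝔼 →ᵃ[ℝ] ℝ) → ℕ := fun h => (E.filter fun x => h x = 0).card
  obtain ⟨h, ⟨hle, hhv, hz⟩, hmax⟩ : ∃ h, Adm h ∧ ∀ h', Adm h' → n h' ≤ n h := by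
    let s : Set ℕ := n '' {h | Adm h}
    have hs : s.Nonempty := ⟨n h₀, h₀, ⟨hh₀, hv₀, fun _ _ h => h⟩, rfl⟩
    have hb : BddAbove s := ⟨E.card, by rintro _ ⟨h, -, rfl⟩; exact Finset.card_filter_le _ _⟩
    obtain ⟨h, hA, hn⟩ := Nat.sSup_mem hs hb
    exact ⟨h, hA, fun h' hA' => hn ▸ le_csSup hb ⟨h', hA', rfl⟩⟩
  set Z := E.filter fun x => h x = 0 with hZ
  have hspan : ∀ u ∈ E, u ∈ affineSpan ℝ (insert v (Z : Set 𝔼)) := by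
    intro u₀ hu₀
    by_contra hcon
    obtain ⟨g, hg, hgu⟩ := exists_affineMap_eq_zero_eq_one hcon
    have hgZ : ∀ x ∈ Z, g x = 0 := fun x hx =>
      hg x (subset_affineSpan ℝ _ (Set.mem_insert_of_mem _ hx))
    have hgv : g v = 0 := hg v (subset_affineSpan ℝ _ (Set.mem_insert _ _))
    have hneg : ∀ x ∈ E, x ∉ Z → h x < 0 := fun x hx hxZ =>
      lt_of_le_of_ne (hle x hx) fun h0 => hxZ (Finset.mem_filter.2 ⟨hx, h0⟩)
    have hu₀Z : u₀ ∉ Z := fun hu => by simp [hgZ u₀ hu] at hgu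
    obtain ⟨m, hm, hmm⟩ := Finset.exists_max_image (E \ Z) (fun u => g u / -h u)
      ⟨u₀, Finset.mem_sdiff.2 ⟨hu₀, hu₀Z⟩⟩
    rw [Finset.mem_sdiff] at hm
    set t := g m / -h m with ht
    have hhm := hneg m hm.1 hm.2
    have htpos : 0 < t := by
      refine lt_of_lt_of_le ?_ (hmm u₀ (Finset.mem_sdiff.2 ⟨hu₀, hu₀Z⟩))
      have := hneg u₀ hu₀ hu₀Z
      simp only [hgu]
      exact div_pos one_pos (by linarith)
    have hval : ∀ x, (g + t • h) x = g x + t * h x := fun x => rfl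
    have hZ' : ∀ x ∈ Z, (g + t • h) x = 0 := fun x hx => by
      rw [hval, hgZ x hx, (Finset.mem_filter.1 hx).2]
      ring
    have hAdm : Adm (g + t • h) := by
      refine ⟨fun x hx => ?_, ?_, fun x hx h0 => hZ' x (Finset.mem_filter.2 ⟨hx, hz x hx h0⟩)⟩
      · by_cases hxZ : x ∈ Z
        · exact (hZ' x hxZ).le
        · have h1 := hmm x (Finset.mem_sdiff.2 ⟨hx, hxZ⟩)
          have h2 := hneg x hx hxZ
          rw [div_le_iff₀ (by linarith)] at h1
          rw [hval]
          linarith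
      · rw [hval, hgv]
        nlinarith
    have hlt : n h < n (g + t • h) := by
      refine Finset.card_lt_card (Finset.ssubset_iff_subset_ne.2 ⟨fun x hx => ?_, fun heq => ?_⟩)
      · exact Finset.mem_filter.2 ⟨(Finset.mem_filter.1 hx).1, hZ' x hx⟩
      · refine hm.2 ?_
        rw [hZ, heq, Finset.mem_filter]
        refine ⟨hm.1, ?_⟩
        rw [hval, ht, div_neg, neg_mul, div_mul_cancel₀ _ hhm.ne, add_neg_cancel]
    exact absurd (hmax _ hAdm) (not_le.2 hlt)
  have hrank : d ≤ Module.finrank ℝ (vectorSpan ℝ (insert v (Z : Set 𝔼))) := by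
    rw [← hdim, pdim, hP, affineSpan_convexHull, ← direction_affineSpan]
    exact Submodule.finrank_mono (AffineSubspace.direction_le (affineSpan_le.2 hspan))
  have hZne : Z.Nonempty := by
    rw [Finset.nonempty_iff_ne_empty]
    intro h0
    rw [h0, Finset.coe_empty, insert_empty_eq, vectorSpan_singleton, finrank_bot] at hrank
    omega
  have hleP : ∀ x ∈ P, h x ≤ 0 := hP ▸ affineMap_nonpos_of_convexHull hle
  have hZF : (Z : Set 𝔼) ⊆ {x ∈ P | h x = 0} := fun x hx =>
    ⟨hEP x (Finset.mem_filter.1 hx).1, (Finset.mem_filter.1 hx).2⟩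
  have hne : {x ∈ P | h x = 0}.Nonempty := hZne.to_set.mono hZF
  refine ⟨_, isFace_of_affineMap h hleP, hne, le_antisymm ?_ ?_, fun hvF => hhv.ne hvF.2,
    fun x hx h0 => ⟨hEP x hx, hz x hx h0⟩⟩
  · have hlt : affineSpan ℝ {x ∈ P | h x = 0} < affineSpan ℝ P := by
      refine lt_of_le_of_ne (affineSpan_mono ℝ fun x hx => hx.1) fun heq => ?_
      have hvm : v ∈ affineSpan ℝ {x ∈ P | h x = 0} :=
        heq ▸ subset_affineSpan ℝ _ (hEP v hv)
      have hker : affineSpan ℝ {x ∈ P | h x = 0} ≤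
          (affineSpan ℝ ({0} : Set ℝ)).comap h := by
        rw [affineSpan_le]
        intro x hx
        simp [hx.2]
      have := hker hvm
      simp at this
      exact hhv.ne this
    have := Submodule.finrank_lt_finrank_of_lt
      (AffineSubspace.direction_lt_of_nonempty hlt ((affineSpan_nonempty ℝ).2 hne))
    rw [pdim] at hdim ⊢
    omega
  · have h1 := finrank_vectorSpan_insert_le_set ℝ (Z : Set 𝔼) v
    have h2 : Module.finrank ℝ (vectorSpan ℝ (Z : Set 𝔼)) ≤ pdim {x ∈ P | h x = 0} := by
      rw [pdim, direction_affineSpan]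
      exact Submodule.finrank_mono (vectorSpan_mono ℝ hZF)
    omega

/-- An extreme point of a polytope is separated from the other vertices. -/
lemma exists_affineMap_of_mem_extremePoints {E : Finset 𝔼} {e : 𝔼}
    (he : e ∈ (convexHull ℝ (E : Set 𝔼)).extremePoints ℝ) :
    ∃ h : 𝔼 →ᵃ[ℝ] ℝ, h e = 0 ∧ ∀ x ∈ E, x ≠ e → h x < 0 := by
  have hnot : e ∉ convexHull ℝ ((E : Set 𝔼) \ {e}) := fun hmem =>
    (((convex_convexHull ℝ _).mem_extremePoints_iff_mem_sdiff_convexHull_sdiff).1 he).2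
      (convexHull_mono (Set.sdiff_subset_sdiff_left (subset_convexHull ℝ _)) hmem)
  obtain ⟨f, u, hf, hfe⟩ := geometric_hahn_banach_closed_point (convex_convexHull ℝ _)
    ((E.finite_toSet.subset Set.sdiff_subset).isClosed_convexHull ℝ) hnot
  refine ⟨f.toLinearMap.toAffineMap - AffineMap.const ℝ 𝔼 (f e), by simp, fun x hx hxe => ?_⟩
  have := hf x (subset_convexHull ℝ _ ⟨hx, hxe⟩)
  simp
  linarith

/-- In a polytope, given a facet whose vertices `Z` are affinely independent and `v ∈ Z`, some
other facet contains `Z \ {v}` but not `v`. -/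
lemma exists_adjacent_facet {P F : Set 𝔼} {E Z : Finset 𝔼} {d : ℕ}
    (hP : P = convexHull ℝ (E : Set 𝔼)) (hdim : pdim P = d) (hd : 1 ≤ d)
    (hF : IsFace P F) (hZ : ∀ x, x ∈ Z ↔ x ∈ E ∧ x ∈ F)
    (hind : AffineIndependent ℝ (Subtype.val : {x // x ∈ Z} → 𝔼)) {v : 𝔼} (hv : v ∈ Z) :
    ∃ G, IsFace P G ∧ G.Nonempty ∧ pdim G = d - 1 ∧ v ∉ G ∧ ∀ x ∈ Z, x ≠ v → x ∈ G := by
  classical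
  obtain ⟨f, hf, rfl⟩ := hF.exists_affineMap
  have hEP : ∀ x ∈ E, x ∈ P := fun x hx => hP ▸ subset_convexHull ℝ _ hx
  have hnot : v ∉ affineSpan ℝ ((Z : Set 𝔼) \ {v}) := by
    have := hind.notMem_affineSpan_sdiff ⟨v, hv⟩ Set.univ
    convert this using 3
    ext x
    simp [and_comm]
  obtain ⟨g, hg, hgv⟩ := exists_affineMap_eq_zero_eq_one hnot
  -- `-g + t • f` is valid on `P` for large `t`
  obtain ⟨t, ht⟩ : ∃ t : ℝ, ∀ x ∈ E \ Z, g x / f x ≤ t := by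
    obtain ⟨t, ht⟩ := ((E \ Z).image fun x => g x / f x).bddAbove
    exact ⟨t, fun x hx => ht (Finset.mem_coe.2 (Finset.mem_image_of_mem _ hx))⟩
  have hval : ∀ x, (-g + t • f) x = -g x + t * f x := fun x => rfl
  have hfZ : ∀ x ∈ Z, f x = 0 := fun x hx => ((hZ x).1 hx).2.2
  have hgZ : ∀ x ∈ Z, x ≠ v → g x = 0 := fun x hx hxv =>
    hg x (subset_affineSpan ℝ _ ⟨hx, hxv⟩)
  obtain ⟨G, hG, hne, hGd, hvG, hGz⟩ := exists_facet_of_affineMap hP hdim hd (-g + t • f)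
    (fun x hx => by
      rw [hval]
      by_cases hxZ : x ∈ Z
      · rw [hfZ x hxZ]
        by_cases hxv : x = v
        · rw [hxv, hgv]
          norm_num
        · rw [hgZ x hxZ hxv]
          norm_num
      · have hneg : f x < 0 := lt_of_le_of_ne (hf x (hEP x hx)) fun h0 =>
          hxZ ((hZ x).2 ⟨hx, hEP x hx, h0⟩)
        have := ht x (Finset.mem_sdiff.2 ⟨hx, hxZ⟩)
        rw [div_le_iff_of_neg hneg] at this
        linarith)
    ((hZ v).1 hv).1 (by rw [hval, hfZ v hv, hgv]; norm_num)
  refine ⟨G, hG, hne, hGd, hvG, fun x hx hxv => hGz x ((hZ x).1 hx).1 ?_⟩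
  rw [hval, hfZ x hx, hgZ x hx hxv]
  ring

end Polytope

theorem stmt18 {N : ℕ} (P : Set (EuclideanSpace ℝ (Fin N))) (d : ℕ)
    (hP : IsPolytope P) (hdim : pdim P = d)
    (hsimplicial : IsSimplicial P d) (hvert : d + 2 ≤ (vertexSet P).ncard) :
    2 * d ≤ fCount P (d - 1) := by
  classical
  rcases Nat.eq_zero_or_pos d with rfl | hd
  · simp
  obtain ⟨E, hE, hconv⟩ := hP.exists_extremePoints
  have hEcard : d + 2 ≤ E.card := by
    rw [← Set.ncard_coe_finset]
    exact hvert.trans (Set.ncard_le_ncard (hE ▸ vertexSet_subset_extremePoints P))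
  set Φ := {F : Set (EuclideanSpace ℝ (Fin N)) | IsFace P F ∧ F.Nonempty ∧ pdim F = d - 1} with hΦ
  let Z : Set (EuclideanSpace ℝ (Fin N)) → Finset (EuclideanSpace ℝ (Fin N)) :=
    fun F => E.filter (· ∈ F)
  have hZ : ∀ F x, x ∈ Z F ↔ x ∈ E ∧ x ∈ F := fun F x => Finset.mem_filter
  have hsimp : ∀ F ∈ Φ, (Z F).card = d ∧
      AffineIndependent ℝ (Subtype.val : {x // x ∈ Z F} → EuclideanSpace ℝ (Fin N)) ∧
      F = convexHull ℝ (Z F : Set (EuclideanSpace ℝ (Fin N))) := by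
    intro F hF
    have := hF.1.extremePoints_of_isSimplex hE (hsimplicial F hF.1 hF.2.1 hF.2.2) hF.2.2 (hZ F)
    rwa [Nat.sub_add_cancel hd] at this
  have hinj : Set.InjOn Z Φ := by
    intro F hF G hG h
    rw [(hsimp F hF).2.2, (hsimp G hG).2.2, h]
  have hfin : Φ.Finite := by
    refine Set.Finite.of_finite_image (E.powerset.finite_toSet.subset ?_) hinj
    rintro _ ⟨F, -, rfl⟩
    exact Finset.mem_coe.2 (Finset.mem_powerset.2 (Finset.filter_subset _ _))
  have hcount : 2 * d ≤ (hfin.toFinset.image Z).card := by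
    refine two_mul_le_card_of_ridges hd ?_ ?_ hEcard ?_
    · simp only [Finset.mem_image, Set.Finite.mem_toFinset, forall_exists_index, and_imp]
      rintro _ F hF rfl
      exact (hsimp F hF).1
    · simp only [Finset.mem_image, Set.Finite.mem_toFinset, forall_exists_index, and_imp]
      rintro _ F hF rfl v hv
      obtain ⟨G, hG, hne, hGd, hvG, hGs⟩ :=
        exists_adjacent_facet hconv hdim hd hF.1 (hZ F) (hsimp F hF).2.1 hv
      refine ⟨Z G, ⟨G, ⟨hG, hne, hGd⟩, rfl⟩, fun h => hvG ((hZ G v).1 h).2, fun x hx => ?_⟩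
      rw [Finset.mem_erase] at hx
      exact (hZ G x).2 ⟨((hZ F x).1 hx.2).1, hGs x hx.2 hx.1⟩
    · intro e he
      have hext : e ∈ (convexHull ℝ (E : Set (EuclideanSpace ℝ (Fin N)))).extremePoints ℝ := by
        rw [← hconv, ← hE]
        exact he
      obtain ⟨h, hhe, hneg⟩ := exists_affineMap_of_mem_extremePoints hext
      obtain ⟨v, hv, hve⟩ := Finset.exists_mem_ne (s := E) (by omega) e
      obtain ⟨F, hF, hne, hFd, -, hFz⟩ := exists_facet_of_affineMap hconv hdim hd h
        (fun x hx => by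
          by_cases hxe : x = e
          · rw [hxe, hhe]
          · exact (hneg x hx hxe).le) hv (hneg v hv hve)
      exact ⟨Z F, Finset.mem_image_of_mem _ (hfin.mem_toFinset.2 ⟨hF, hne, hFd⟩),
        (hZ F e).2 ⟨he, hFz e he hhe⟩⟩
  rw [fCount, Set.ncard_eq_toFinset_card _ hfin]
  exact hcount.trans Finset.card_image_le
end

section
/- If P is a d-polytope with d+s vertices (s ≥ 2, d ≥ s) attaining f_k(P) = φ_k(d+s,d) for some 1 ≤ k ≤ d-2, then every vertex of P lying outside a chosen facet with at most d+s-2 vertices is a simple vertex (contained in exactly d edges). -/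
open Set

lemma phi_eq {d s : ℕ} (h : s ≤ d + 1) (k : ℕ) :
    phi d s k = (d + 1).choose (k + 1) + d.choose (k + 1) - (d + 1 - s).choose (k + 1) := by
  have hC : ∀ n m : ℕ, C n m = n.choose m := fun n m => by simp [C]
  rw [phi, ← hC, ← hC, ← hC]
  push_cast [h]
  rfl

lemma choose_add_choose_le (x p q k : ℕ) :
    (x + p).choose k + (x + q).choose k ≤ (x + p + q).choose k + x.choose k := by
  induction q with
  | zero => simp
  | succ q ih =>
    rcases k with _ | k
    · simp
    rw [← add_assoc, ← add_assoc, Nat.choose_succ_succ', Nat.choose_succ_succ' (x + p + q)]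
    have := Nat.choose_le_choose k (by omega : x + q ≤ x + p + q)
    omega

lemma sum_choose_add_choose (k : ℕ) {n t : ℕ} (h : t ≤ n) :
    ∑ i ∈ Finset.range t, (n - 1 - i).choose k + (n - t).choose (k + 1) = n.choose (k + 1) := by
  induction t with
  | zero => simp
  | succ t ih =>
    rw [← ih (by omega), Finset.sum_range_succ, show n - t = n - 1 - t + 1 by omega,
      Nat.choose_succ_succ', show n - (t + 1) = n - 1 - t by omega]
    omega

lemma phi_le_sum {d s m k : ℕ} (hm : 2 ≤ m) (hms : m ≤ s) (hsd : s ≤ d) :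
    phi d s k ≤ ((d.choose k + ∑ i ∈ Finset.range (m - 1), (d - 1 - i).choose k : ℕ) : ℤ) +
      phi (d - 1) (s + 1 - m) k := by
  rw [phi_eq (by omega), phi_eq (by omega)]
  have h1 := sum_choose_add_choose k (by omega : m - 1 ≤ d)
  have h2 := choose_add_choose_le (d + 1 - s) (m - 2) (s - m) (k + 1)
  rw [show d + 1 - s + (m - 2) + (s - m) = d - 1 by omega,
    show d + 1 - s + (m - 2) = d - 1 + 1 - (s + 1 - m) by omega,
    show d + 1 - s + (s - m) = d - (m - 1) by omega] at h2
  rw [Nat.choose_succ_succ', show d - 1 + 1 = d by omega] at *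
  omega

section FaceLattice

variable {α : Type*} [SemilatticeInf α]

/-- A strictly monotone rank function for which every element `a` below `b` is separated from
any `w ≤ b` with `w ≰ a` by an element of corank one below `b`. Face lattices of polytopes
satisfy this. -/
structure IsFaceRank (rk : α → ℕ) : Prop where
  strictMono : StrictMono rk
  exists_separating : ∀ {a b w : α}, a ≤ b → w ≤ b → ¬ w ≤ a →
    ∃ h, a ≤ h ∧ h ≤ b ∧ ¬ w ≤ h ∧ rk h + 1 = rk b

namespace IsFaceRank

variable {rk : α → ℕ}

lemma eq_of_le_of_rk_le (hr : IsFaceRank rk) {a b : α} (h : a ≤ b) (h' : rk b ≤ rk a) : a = b := by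
  rcases h.eq_or_lt with h | h
  · exact h
  · exact absurd (hr.strictMono h) (by omega)

lemma not_le_of_rk_lt (hr : IsFaceRank rk) {a b : α} (h : rk a < rk b) : ¬ b ≤ a := fun h' =>
  absurd (hr.strictMono.monotone h') (by omega)

lemma exists_coatom (hr : IsFaceRank rk) {a b : α} (h : a ≤ b) (h' : rk a < rk b) :
    ∃ c, a ≤ c ∧ c ≤ b ∧ rk c + 1 = rk b := by
  obtain ⟨c, h1, h2, -, h3⟩ := hr.exists_separating h le_rfl (hr.not_le_of_rk_lt h')
  exact ⟨c, h1, h2, h3⟩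

lemma exists_between (hr : IsFaceRank rk)
    {a b : α} (h : a ≤ b) {j : ℕ} (h1 : rk a ≤ j) (h2 : j ≤ rk b) :
    ∃ c, a ≤ c ∧ c ≤ b ∧ rk c = j := by
  obtain ⟨n, hn⟩ := Nat.exists_eq_add_of_le h2
  induction n generalizing b with
  | zero => exact ⟨b, h, le_rfl, by omega⟩
  | succ n ih =>
    obtain ⟨c, hac, hcb, hc⟩ := hr.exists_coatom h (by omega)
    obtain ⟨e, h3, h4, h5⟩ := ih hac (by omega) (by omega)
    exact ⟨e, h3, h4.trans hcb, h5⟩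

lemma exists_atom (hr : IsFaceRank rk) {a x y : α} (hx : a ≤ x) (hy : a ≤ y) (hyx : ¬ y ≤ x) :
    ∃ v, a ≤ v ∧ v ≤ y ∧ ¬ v ≤ x ∧ rk v = rk a + 1 := by
  induction hn : rk y using Nat.strong_induction_on generalizing y with
  | _ n ih =>
    have hay : rk a < rk y := by
      refine hr.strictMono (lt_of_le_of_ne hy ?_)
      rintro rfl
      exact hyx hx
    by_cases h1 : rk y = rk a + 1
    · exact ⟨y, hy, le_rfl, hyx, h1⟩
    have descend : ∀ h, a ≤ h → h ≤ y → rk h + 1 = rk y → ¬ h ≤ x →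
        ∃ v, a ≤ v ∧ v ≤ y ∧ ¬ v ≤ x ∧ rk v = rk a + 1 := by
      intro h hah hhy hh hhx
      obtain ⟨v, h2, h3, h4, h5⟩ := ih (rk h) (by omega) hah hhx rfl
      exact ⟨v, h2, h3.trans hhy, h4, h5⟩
    obtain ⟨h, hah, hhy, hh⟩ := hr.exists_coatom hy hay
    by_cases hhx : h ≤ x
    · obtain ⟨h', hah', hhy', hhh', hh'⟩ :=
        hr.exists_separating hy hhy (hr.not_le_of_rk_lt (by omega))
      refine descend h' hah' hhy' hh' fun hx' => ?_
      have hlt : rk (x ⊓ y) < rk y :=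
        hr.strictMono (lt_of_le_of_ne inf_le_right fun e => hyx (e ▸ inf_le_left))
      have e1 := hr.eq_of_le_of_rk_le (le_inf hhx hhy) (by omega)
      have e2 := hr.eq_of_le_of_rk_le (le_inf hx' hhy') (by omega)
      exact hhh' (e1.trans e2.symm).le
    · exact descend h hah hhy hh hhx

/-- Given finitely many atoms different from `v`, there is an element above `v` avoiding all of
them whose corank is their number. -/
lemma exists_avoiding (hr : IsFaceRank rk) {b v : α} (hv : rk v = 1) (hvb : v ≤ b) (T : Finset α)
    (hT : ∀ u ∈ T, rk u = 1 ∧ u ≠ v) (hcard : T.card < rk b) :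
    ∃ h, v ≤ h ∧ h ≤ b ∧ (∀ u ∈ T, ¬ u ≤ h) ∧ rk h + T.card = rk b := by
  classical
  induction T using Finset.induction_on with
  | empty => exact ⟨b, hvb, le_rfl, by simp, by simp⟩
  | insert u T hu ih =>
    rw [Finset.card_insert_of_notMem hu] at hcard ⊢
    obtain ⟨h, hvh, hhb, hav, hh⟩ :=
      ih (fun w hw => hT w (Finset.mem_insert_of_mem hw)) (by omega)
    obtain ⟨hu1, huv⟩ := hT u (Finset.mem_insert_self _ _)
    have key : ∃ h', v ≤ h' ∧ h' ≤ h ∧ ¬ u ≤ h' ∧ rk h' + 1 = rk h := by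
      by_cases huh : u ≤ h
      · exact hr.exists_separating hvh huh
          fun h' => huv (hr.eq_of_le_of_rk_le h' (by omega))
      · obtain ⟨h', h1, h2, h3⟩ := hr.exists_coatom hvh (by omega)
        exact ⟨h', h1, h2, fun h4 => huh (h4.trans h2), h3⟩
    obtain ⟨h', h1, h2, h3, h4⟩ := key
    refine ⟨h', h1, h2.trans hhb, fun w hw => ?_, by omega⟩
    rcases Finset.mem_insert.1 hw with rfl | hw
    · exact h3
    · exact fun h5 => hav w hw (h5.trans h2)

end IsFaceRank

variable [Fintype α]

open Classical in
/-- The elements of rank `k` in the interval from `a` to `b`. -/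
noncomputable def level (rk : α → ℕ) (a b : α) (k : ℕ) : Finset α :=
  Finset.univ.filter fun x => a ≤ x ∧ x ≤ b ∧ rk x = k

@[simp] lemma mem_level {rk : α → ℕ} {a b x : α} {k : ℕ} :
    x ∈ level rk a b k ↔ a ≤ x ∧ x ≤ b ∧ rk x = k := by simp [level]

namespace IsFaceRank

variable {rk : α → ℕ}

lemma disjoint_level_and_union_subset [DecidableEq α] {a b F v : α} (hF : F ≤ b) (hav : a ≤ v)
    (hvF : ¬ v ≤ F) (k : ℕ) :
    Disjoint (level rk a F k) (level rk v b k) ∧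
      level rk a F k ∪ level rk v b k ⊆ level rk a b k := by
  constructor
  · rw [Finset.disjoint_left]
    intro x hx hx'
    rw [mem_level] at hx hx'
    exact hvF (hx'.1.trans hx.2.1)
  · intro x hx
    rw [Finset.mem_union, mem_level, mem_level] at hx
    rw [mem_level]
    rcases hx with ⟨h1, h2, h3⟩ | ⟨h1, h2, h3⟩
    · exact ⟨h1, h2.trans hF, h3⟩
    · exact ⟨hav.trans h1, h2, h3⟩

lemma choose_le_card_level (hr : IsFaceRank rk)
    {n : ℕ} : ∀ {a b : α}, a ≤ b → rk b = rk a + n → ∀ j,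
    n.choose j ≤ (level rk a b (rk a + j)).card := by
  classical
  induction n with
  | zero =>
    intro a b hab hb j
    rcases j with _ | j
    · exact Finset.card_pos.2 ⟨a, by simp [hab]⟩
    · simp
  | succ n ih =>
    intro a b hab hb j
    rcases j with _ | j
    · simpa using Finset.card_pos.2 ⟨a, by simp [hab]⟩
    obtain ⟨F, haF, hFb, hF⟩ := hr.exists_coatom hab (by omega)
    obtain ⟨v, hav, hvb, hvF, hv⟩ :=
      hr.exists_atom haF hab (hr.not_le_of_rk_lt (show rk F < rk b by omega))
    obtain ⟨hdis, hsub⟩ := disjoint_level_and_union_subset hFb hav hvF (rk := rk) (rk a + (j + 1))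
    have h1 := ih haF (by omega) (j + 1)
    have h2 := ih hvb (by omega) j
    have h3 := Finset.card_le_card hsub
    rw [Finset.card_union_of_disjoint hdis] at h3
    rw [show rk v + j = rk a + (j + 1) by omega] at h2
    rw [Nat.choose_succ_succ']
    omega

/-- An interval with the least possible number of elements of some proper rank has the least
possible number of coatoms. -/
lemma card_coatoms_of_card_level (hr : IsFaceRank rk)
    {n : ℕ} : ∀ {a b : α}, a ≤ b → rk b = rk a + n → ∀ {j},
    1 ≤ j → j < n → (level rk a b (rk a + j)).card ≤ n.choose j →
    (level rk a b (rk a + (n - 1))).card = n := by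
  classical
  induction n with
  | zero => intro a b _ _ j h1 h2; omega
  | succ n ih =>
    intro a b hab hb j hj hjn hcard
    obtain ⟨j, rfl⟩ := Nat.exists_eq_add_of_le' hj
    have heq : ∀ F v, a ≤ F → F ≤ b → rk F + 1 = rk b → a ≤ v → v ≤ b → ¬ v ≤ F →
        rk v = rk a + 1 →
        level rk a F (rk a + (j + 1)) ∪ level rk v b (rk a + (j + 1)) =
            level rk a b (rk a + (j + 1)) ∧
          (level rk v b (rk v + j)).card ≤ n.choose j := by
      intro F v haF hFb hF hav hvb hvF hv
      obtain ⟨hdis, hsub⟩ := disjoint_level_and_union_subset hFb hav hvF (rk := rk) (rk a + (j + 1))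
      have h1 := hr.choose_le_card_level haF (by omega : rk F = rk a + n) (j + 1)
      have h2 := hr.choose_le_card_level hvb (by omega : rk b = rk v + n) j
      have h3 := Finset.card_le_card hsub
      rw [Finset.card_union_of_disjoint hdis] at h3
      rw [show rk v + j = rk a + (j + 1) by omega] at h2 ⊢
      rw [Nat.choose_succ_succ'] at hcard
      refine ⟨Finset.eq_of_subset_of_card_le hsub ?_, by omega⟩
      rw [Finset.card_union_of_disjoint hdis]
      omega
    have huniq : ∀ F v u, a ≤ F → F ≤ b → rk F + 1 = rk b → a ≤ v → v ≤ b → ¬ v ≤ F →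
        rk v = rk a + 1 → a ≤ u → u ≤ b → ¬ u ≤ F → rk u = rk a + 1 → u = v := by
      intro F v u haF hFb hF hav hvb hvF hv hau hub huF hu
      by_contra hne
      obtain ⟨H, huH, hHb, hvH, hH⟩ := hr.exists_separating hub hvb
        fun h => hne (hr.eq_of_le_of_rk_le h (by omega)).symm
      obtain ⟨x, hux, hxH, hx⟩ := hr.exists_between huH
        (by omega : rk u ≤ rk a + (j + 1)) (by omega)
      have hmem : x ∈ level rk a b (rk a + (j + 1)) :=
        mem_level.2 ⟨hau.trans hux, hxH.trans hHb, hx⟩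
      rw [← (heq F v haF hFb hF hav hvb hvF hv).1, Finset.mem_union, mem_level, mem_level] at hmem
      rcases hmem with h | h
      · exact huF (hux.trans h.2.1)
      · exact hvH (h.1.trans hxH)
    have hsing : ∀ F G v, a ≤ F → F ≤ b → rk F + 1 = rk b → a ≤ G → G ≤ b → rk G + 1 = rk b →
        a ≤ v → v ≤ b → ¬ v ≤ F → ¬ v ≤ G → rk v = rk a + 1 → F = G := by
      intro F G v haF hFb hF haG hGb hG hav hvb hvF hvG hv
      by_contra hne
      obtain ⟨u, hau, huG, huF, hu⟩ := hr.exists_atom haF haG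
        fun h => hne (hr.eq_of_le_of_rk_le h (by omega)).symm
      exact hvG (huniq F v u haF hFb hF hav hvb hvF hv hau (huG.trans hGb) huF hu ▸ huG)
    refine le_antisymm ?_ (by simpa using hr.choose_le_card_level hab hb n)
    simp only [Nat.add_sub_cancel]
    rcases Nat.eq_zero_or_pos j with rfl | hjpos
    · simp only [zero_add, Nat.choose_one_right] at hcard
      refine le_trans ?_ hcard
      refine Finset.card_le_card_of_forall_subsingleton (fun F v => ¬ v ≤ F) ?_ ?_
      · intro F hF
        rw [mem_level] at hF
        obtain ⟨v, h1, h2, h3, h4⟩ :=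
          hr.exists_atom hF.1 hab (hr.not_le_of_rk_lt (show rk F < rk b by omega))
        exact ⟨v, mem_level.2 ⟨h1, h2, h4⟩, h3⟩
      · rintro v hv F ⟨hF, hvF⟩ G ⟨hG, hvG⟩
        rw [mem_level] at hv hF hG
        exact hsing F G v hF.1 hF.2.1 (by omega) hG.1 hG.2.1 (by omega) hv.1 hv.2.1 hvF hvG hv.2.2
    · obtain ⟨F, haF, hFb, hF⟩ := hr.exists_coatom hab (by omega)
      obtain ⟨v, hav, hvb, hvF, hv⟩ :=
        hr.exists_atom haF hab (hr.not_le_of_rk_lt (show rk F < rk b by omega))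
      have h1 := ih hvb (by omega) hjpos (by omega)
        (heq F v haF hFb hF hav hvb hvF hv).2
      have hsub : level rk a b (rk a + n) ⊆ insert F (level rk v b (rk v + (n - 1))) := by
        intro G hG
        rw [mem_level] at hG
        rw [Finset.mem_insert, mem_level]
        by_cases hvG : v ≤ G
        · exact Or.inr ⟨hvG, hG.2.1, by omega⟩
        · exact Or.inl (hsing F G v haF hFb hF hG.1 hG.2.1 (by omega) hav hvb hvF hvG hv).symm
      have h2 := (Finset.card_le_card hsub).trans (Finset.card_insert_le _ _)
      omega

/-- Elements of rank `k + 1` above one of several atoms, with the first atom counted exactly. -/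
lemma card_level_add_sum_le (hr : IsFaceRank rk)
    {b v : α} (hv : rk v = 1) (hvb : v ≤ b) {d : ℕ} (hb : rk b = d + 1)
    (k : ℕ) (S : Finset α) (hS : ∀ x ∈ level rk v b (k + 1), x ∈ S) (T : Finset α)
    (hT : ∀ u ∈ T, rk u = 1 ∧ u ≤ b ∧ u ≠ v ∧ ∀ x ∈ level rk u b (k + 1), x ∈ S)
    (hcard : T.card ≤ d) :
    (level rk v b (k + 1)).card + ∑ i ∈ Finset.range T.card, (d - 1 - i).choose k ≤ S.card := by
  classical
  induction T using Finset.induction_on generalizing S with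
  | empty => simpa using Finset.card_le_card hS
  | insert u T hu ih =>
    rw [Finset.card_insert_of_notMem hu] at hcard ⊢
    rw [Finset.sum_range_succ]
    obtain ⟨hu1, hub, huv, huS⟩ := hT u (Finset.mem_insert_self _ _)
    have hT' := fun w hw => hT w (Finset.mem_insert_of_mem hw)
    obtain ⟨h, huh, hhb, hav, hh⟩ := hr.exists_avoiding hu1 hub (insert v T)
      (by
        intro w hw
        rcases Finset.mem_insert.1 hw with rfl | hw
        · exact ⟨hv, huv.symm⟩
        · exact ⟨(hT' w hw).1, fun e => hu (e ▸ hw)⟩)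
      (by have := Finset.card_insert_le v T; omega)
    have hvT : v ∉ T := fun h => (hT' v h).2.2.1 rfl
    rw [Finset.card_insert_of_notMem hvT] at hh
    have h1 := hr.choose_le_card_level huh (n := d - 1 - T.card) (by omega) k
    rw [hu1, add_comm 1 k] at h1
    have hsub : level rk u h (k + 1) ⊆ S := fun x hx => by
      rw [mem_level] at hx
      exact huS x (mem_level.2 ⟨hx.1, hx.2.1.trans hhb, hx.2.2⟩)
    have hnot : ∀ w ∈ insert v T, ∀ x ∈ level rk w b (k + 1), x ∉ level rk u h (k + 1) := by
      intro w hw x hx hx'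
      rw [mem_level] at hx hx'
      exact hav w hw (hx.1.trans hx'.2.1)
    have h2 := ih (S \ level rk u h (k + 1))
      (fun x hx => Finset.mem_sdiff.2 ⟨hS x hx, hnot v (Finset.mem_insert_self _ _) x hx⟩)
      (fun w hw => ⟨(hT' w hw).1, (hT' w hw).2.1, (hT' w hw).2.2.1, fun x hx =>
        Finset.mem_sdiff.2 ⟨(hT' w hw).2.2.2 x hx, hnot w (Finset.mem_insert_of_mem hw) x hx⟩⟩)
      (by omega)
    have h3 := Finset.card_sdiff_add_card_eq_card hsub
    omega

variable [OrderBot α]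

/-- The elements of rank `k + 1` outside a coatom `F`, bounded via the atoms outside `F`. -/
lemma card_level_add_card_level_le (hr : IsFaceRank rk)
    (h0 : rk ⊥ = 0) {b F v : α} {d s : ℕ} (hb : rk b = d + 1)
    (hs : s ≤ d) (hF : F ≤ b) (hF1 : rk F = d) (hatoms : (level rk ⊥ b 1).card = d + s)
    (hv : v ∈ level rk ⊥ b 1) (hvF : ¬ v ≤ F) (k : ℕ) :
    ∃ m, 1 ≤ m ∧ m ≤ s ∧ (level rk ⊥ F 1).card + m = d + s ∧
      (level rk v b (k + 1)).card + ∑ i ∈ Finset.range (m - 1), (d - 1 - i).choose k +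
        (level rk ⊥ F (k + 1)).card ≤ (level rk ⊥ b (k + 1)).card := by
  classical
  have hlow := hr.choose_le_card_level (bot_le (a := F)) (n := d) (by omega) 1
  rw [h0, zero_add, Nat.choose_one_right] at hlow
  have hFb : ∀ j, level rk ⊥ F j ⊆ level rk ⊥ b j := fun j x hx => by
    rw [mem_level] at hx ⊢
    exact ⟨hx.1, hx.2.1.trans hF, hx.2.2⟩
  set M := level rk ⊥ b 1 \ level rk ⊥ F 1 with hM
  have hMcard : M.card + (level rk ⊥ F 1).card = d + s :=
    (Finset.card_sdiff_add_card_eq_card (hFb 1)).trans hatoms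
  have hvM : v ∈ M := by
    rw [hM, Finset.mem_sdiff]
    exact ⟨hv, fun h => hvF (mem_level.1 h).2.1⟩
  have hpos : 1 ≤ M.card := Finset.card_pos.2 ⟨v, hvM⟩
  have hMmem : ∀ u ∈ M, rk u = 1 ∧ u ≤ b ∧ ∀ x ∈ level rk u b (k + 1),
      x ∈ level rk ⊥ b (k + 1) \ level rk ⊥ F (k + 1) := by
    intro u hu
    rw [hM, Finset.mem_sdiff, mem_level, mem_level] at hu
    refine ⟨hu.1.2.2, hu.1.2.1, fun x hx => ?_⟩
    rw [mem_level] at hx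
    rw [Finset.mem_sdiff, mem_level, mem_level]
    exact ⟨⟨bot_le, hx.2⟩, fun h => hu.2 ⟨bot_le, hx.1.trans h.2.1, hu.1.2.2⟩⟩
  have h1 := hr.card_level_add_sum_le (hMmem v hvM).1 (hMmem v hvM).2.1 hb k
    (level rk ⊥ b (k + 1) \ level rk ⊥ F (k + 1)) (hMmem v hvM).2.2 (M.erase v)
    (fun u hu => ⟨(hMmem u (Finset.mem_of_mem_erase hu)).1,
      (hMmem u (Finset.mem_of_mem_erase hu)).2.1, Finset.ne_of_mem_erase hu,
      (hMmem u (Finset.mem_of_mem_erase hu)).2.2⟩)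
    (by rw [Finset.card_erase_of_mem hvM]; omega)
  rw [Finset.card_erase_of_mem hvM] at h1
  have h2 := Finset.card_sdiff_add_card_eq_card (hFb (k + 1))
  exact ⟨M.card, hpos, by omega, by omega, by omega⟩

lemma exists_coatom_card_add_two_le (hr : IsFaceRank rk)
    (h0 : rk ⊥ = 0) {n : ℕ} : ∀ {b : α}, rk b = n →
    n < (level rk ⊥ b 1).card →
    ∃ F, F ≤ b ∧ rk F + 1 = n ∧ (level rk ⊥ F 1).card + 2 ≤ (level rk ⊥ b 1).card := by
  classical
  induction n with
  | zero =>
    intro b hb hlt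
    obtain ⟨x, hx⟩ := Finset.card_pos.1 hlt
    rw [mem_level] at hx
    have := hr.strictMono.monotone hx.2.1
    omega
  | succ n ih =>
    intro b hb hlt
    obtain ⟨F, -, hFb, hF⟩ := hr.exists_coatom (bot_le (a := b)) (by omega)
    by_contra! hcon
    have hcF := hcon F hFb (by omega)
    obtain ⟨G, hGF, hG, hGcard⟩ := ih (by omega : rk F = n) (by omega)
    obtain ⟨H, hGH, hHb, hFH, hH⟩ := hr.exists_separating (hGF.trans hFb) hFb
      (hr.not_le_of_rk_lt (by omega : rk G < rk F))
    have hcH := hcon H hHb (by omega)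
    have hFHlt : rk (F ⊓ H) < rk F :=
      hr.strictMono (lt_of_le_of_ne inf_le_left fun e => hFH (e ▸ inf_le_right))
    have hinf : G = F ⊓ H := hr.eq_of_le_of_rk_le (le_inf hGF hGH) (by omega)
    have hsub : level rk ⊥ F 1 ∪ level rk ⊥ H 1 ⊆ level rk ⊥ b 1 := by
      intro x hx
      simp only [Finset.mem_union, mem_level, bot_le, true_and] at hx ⊢
      rcases hx with h | h
      · exact ⟨h.1.trans hFb, h.2⟩
      · exact ⟨h.1.trans hHb, h.2⟩
    have hint : level rk ⊥ F 1 ∩ level rk ⊥ H 1 = level rk ⊥ G 1 := by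
      ext x
      simp only [Finset.mem_inter, mem_level, bot_le, true_and, hinf, le_inf_iff]
      tauto
    have h1 := Finset.card_union_add_card_inter (level rk ⊥ F 1) (level rk ⊥ H 1)
    rw [hint] at h1
    have h2 := Finset.card_le_card hsub
    omega

/-- Grünbaum's lower bound for the number of elements of a given rank. -/
lemma phi_le_card_level (hr : IsFaceRank rk)
    (h0 : rk ⊥ = 0) (k : ℕ) {d : ℕ} : ∀ {s : ℕ} {b : α}, rk b = d + 1 →
    1 ≤ s → s ≤ d → (level rk ⊥ b 1).card = d + s →
    phi d s k ≤ (level rk ⊥ b (k + 1)).card := by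
  induction d with
  | zero => intro s b _ h1 h2; omega
  | succ d ih =>
    intro s b hb hs hsd hatoms
    rcases hs.eq_or_lt with rfl | hs
    · have h1 := hr.choose_le_card_level (bot_le (a := b)) (n := d + 2) (by omega) (k + 1)
      rw [h0, zero_add] at h1
      rw [phi_eq (by omega)]
      simpa using h1
    obtain ⟨F, hFb, hF, hFcard⟩ := hr.exists_coatom_card_add_two_le h0 hb (by omega)
    obtain ⟨v, -, hvb, hvF, hv⟩ := hr.exists_atom bot_le bot_le
      (hr.not_le_of_rk_lt (by omega : rk F < rk b))
    obtain ⟨m, -, hms, hm, hle⟩ := hr.card_level_add_card_level_le h0 hb hsd hFb (by omega) hatoms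
      (mem_level.2 ⟨bot_le, hvb, by omega⟩) hvF k
    have h1 := ih (s := s + 1 - m) (by omega : rk F = d + 1) (by omega) (by omega) (by omega)
    have h2 := phi_le_sum (k := k) (by omega : 2 ≤ m) hms hsd
    have h3 := hr.choose_le_card_level hvb (n := d + 1) (by omega) k
    rw [hv, h0, zero_add, add_comm 1 k] at h3
    simp only [Nat.add_sub_cancel] at h2 hle
    zify at h3 hle
    push_cast at h2
    linarith

/-- Under equality in Grünbaum's bound, an atom outside a coatom that misses at least two atoms
is below the least possible number of coatoms. -/
lemma card_coatoms_of_card_level_eq_phi (hr : IsFaceRank rk) (h0 : rk ⊥ = 0) {b F v : α} {d s k : ℕ}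
    (hb : rk b = d + 1) (hs : 2 ≤ s) (hsd : s ≤ d) (hk1 : 1 ≤ k) (hkd : k < d)
    (hatoms : (level rk ⊥ b 1).card = d + s)
    (heq : ((level rk ⊥ b (k + 1)).card : ℤ) = phi d s k)
    (hF : F ≤ b) (hF1 : rk F = d) (hFatoms : (level rk ⊥ F 1).card ≤ d + s - 2)
    (hv : v ∈ level rk ⊥ b 1) (hvF : ¬ v ≤ F) :
    (level rk v b d).card = d := by
  obtain ⟨m, -, hms, hm, hle⟩ := hr.card_level_add_card_level_le h0 hb hsd hF hF1 hatoms hv hvF k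
  rw [mem_level] at hv
  have h1 := hr.phi_le_card_level h0 k (d := d - 1) (s := s + 1 - m) (by omega : rk F = _)
    (by omega) (by omega) (by omega)
  have h2 := phi_le_sum (k := k) (by omega : 2 ≤ m) hms hsd
  have h3 : (level rk v b (k + 1)).card ≤ d.choose k := by
    zify at hle ⊢
    push_cast at h2
    linarith
  have h4 := hr.card_coatoms_of_card_level hv.2.1 (n := d) (by omega) hk1 hkd
    (by rwa [hv.2.2, add_comm 1 k])
  rwa [hv.2.2, show 1 + (d - 1) = d by omega] at h4

end IsFaceRank

end FaceLattice
section Polytope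

variable {N : ℕ}

/-- The lift of a point to the affine hyperplane at height one. -/
def lift (x : EuclideanSpace ℝ (Fin N)) : ℝ × EuclideanSpace ℝ (Fin N) := (1, x)

/-- The dimension of the cone over `F`, which is `pdim F + 1` for nonempty `F`. -/
noncomputable def coneRank (F : Set (EuclideanSpace ℝ (Fin N))) : ℕ :=
  Module.finrank ℝ (Submodule.span ℝ (lift '' F))

lemma coneRank_empty : coneRank (∅ : Set (EuclideanSpace ℝ (Fin N))) = 0 := by
  simp [coneRank]

lemma coneRank_eq_pdim_add_one {F : Set (EuclideanSpace ℝ (Fin N))} (hF : F.Nonempty) :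
    coneRank F = pdim F + 1 := by
  obtain ⟨p, hp⟩ := hF
  set V := vectorSpan ℝ F with hV
  set I := LinearMap.inr ℝ ℝ (EuclideanSpace ℝ (Fin N)) with hI
  have hsub : ∀ x ∈ F, x - p ∈ V := fun x hx => vsub_mem_vectorSpan ℝ hx hp
  have hspan : Submodule.span ℝ (lift '' F) = Submodule.span ℝ {lift p} ⊔ V.map I := by
    apply le_antisymm
    · rw [Submodule.span_le]
      rintro _ ⟨x, hx, rfl⟩
      refine Submodule.mem_sup.2 ⟨lift p, Submodule.mem_span_singleton_self _, I (x - p),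
        Submodule.mem_map_of_mem (hsub x hx), ?_⟩
      simp [lift, hI]
    · refine sup_le (Submodule.span_mono (by simpa using ⟨p, hp, rfl⟩)) ?_
      rw [hV, vectorSpan_eq_span_vsub_set_right ℝ hp, Submodule.map_span, Submodule.span_le]
      rintro _ ⟨_, ⟨x, hx, rfl⟩, rfl⟩
      have : I (x -ᵥ p) = lift x - lift p := by simp [lift, hI]
      simp only [this]
      exact Submodule.sub_mem _ (Submodule.subset_span ⟨x, hx, rfl⟩)
        (Submodule.subset_span ⟨p, hp, rfl⟩)
  have hinf : Submodule.span ℝ {lift p} ⊓ V.map I = ⊥ := by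
    rw [Submodule.eq_bot_iff]
    rintro x ⟨h1, h2⟩
    obtain ⟨t, rfl⟩ := Submodule.mem_span_singleton.1 h1
    obtain ⟨y, -, hy⟩ := h2
    have ht : 0 = t := by simpa [lift, hI] using congrArg Prod.fst hy
    simp [← ht]
  have h1 := Submodule.finrank_sup_add_finrank_inf_eq (Submodule.span ℝ {lift p}) (V.map I)
  rw [hinf, finrank_bot, finrank_span_singleton (by simp [lift]),
    ← (Submodule.equivMapOfInjective I LinearMap.inr_injective V).finrank_eq] at h1
  rw [coneRank, hspan, pdim, direction_affineSpan, ← hV]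
  omega

lemma coneRank_eq_add_one_iff {F : Set (EuclideanSpace ℝ (Fin N))} {k : ℕ} :
    coneRank F = k + 1 ↔ F.Nonempty ∧ pdim F = k := by
  rcases F.eq_empty_or_nonempty with rfl | hF
  · simp [coneRank_empty]
  · simp [coneRank_eq_pdim_add_one hF, hF]

lemma coneRank_eq_one_iff {F : Set (EuclideanSpace ℝ (Fin N))} :
    coneRank F = 1 ↔ ∃ v, F = {v} := by
  rw [show 1 = 0 + 1 from rfl, coneRank_eq_add_one_iff, pdim, direction_affineSpan,
    Submodule.finrank_eq_zero, vectorSpan_eq_bot_iff_subsingleton,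
    ← Set.exists_eq_singleton_iff_nonempty_subsingleton]

lemma isFace_iff {P F : Set (EuclideanSpace ℝ (Fin N))} :
    IsFace P F ↔ ∃ φ : ℝ × EuclideanSpace ℝ (Fin N) →ₗ[ℝ] ℝ,
      (∀ x ∈ P, φ (lift x) ≤ 0) ∧ F = {x ∈ P | φ (lift x) = 0} := by
  constructor
  · rintro ⟨f, c, h, rfl⟩
    refine ⟨f ∘ₗ LinearMap.snd ℝ ℝ _ - c • LinearMap.fst ℝ ℝ _, fun x hx => ?_, ?_⟩
    · simpa [lift] using h x hx
    · simp [lift, sub_eq_zero]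
  · rintro ⟨φ, h, rfl⟩
    have key : ∀ x, φ (lift x) = φ (0, x) + φ (1, 0) := fun x => by
      rw [← map_add]
      simp [lift]
    refine ⟨φ ∘ₗ LinearMap.inr ℝ ℝ _, -φ (1, 0), fun x hx => ?_, ?_⟩
    · have := h x hx
      rw [key] at this
      simp only [LinearMap.comp_apply, LinearMap.inr_apply]
      linarith
    · ext x
      simp only [Set.mem_ofPred_eq, key, LinearMap.comp_apply, LinearMap.inr_apply,
        eq_neg_iff_add_eq_zero]

lemma IsFace.subset {P F : Set (EuclideanSpace ℝ (Fin N))} (h : IsFace P F) : F ⊆ P := by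
  obtain ⟨f, c, -, rfl⟩ := h
  exact fun x hx => hx.1

lemma IsFace.refl (P : Set (EuclideanSpace ℝ (Fin N))) : IsFace P P :=
  ⟨0, 0, by simp, by simp⟩

lemma IsFace.empty (P : Set (EuclideanSpace ℝ (Fin N))) : IsFace P ∅ :=
  ⟨0, 1, by simp, by simp⟩

lemma IsFace.of_subset {P F G : Set (EuclideanSpace ℝ (Fin N))} (hF : IsFace P F)
    (hFG : F ⊆ G) (hG : G ⊆ P) : IsFace G F := by
  obtain ⟨f, c, h, rfl⟩ := hF
  exact ⟨f, c, fun x hx => h x (hG hx), Set.Subset.antisymm (fun x hx => ⟨hFG hx, hx.2⟩)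
    fun x hx => ⟨hG hx.1, hx.2⟩⟩

lemma IsFace.inter {P F G : Set (EuclideanSpace ℝ (Fin N))} (hF : IsFace P F)
    (hG : IsFace P G) : IsFace P (F ∩ G) := by
  obtain ⟨f, c, hf, rfl⟩ := hF
  obtain ⟨g, e, hg, rfl⟩ := hG
  refine ⟨f + g, c + e, fun x hx => add_le_add (hf x hx) (hg x hx), ?_⟩
  ext x
  simp only [Set.mem_inter_iff, Set.mem_ofPred_eq, LinearMap.add_apply]
  constructor
  · rintro ⟨⟨h, h1⟩, -, h2⟩
    exact ⟨h, by rw [h1, h2]⟩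
  · rintro ⟨h, h1⟩
    have h2 := hf x h
    have h3 := hg x h
    exact ⟨⟨h, by linarith⟩, h, by linarith⟩

lemma map_lift_sum (φ : ℝ × EuclideanSpace ℝ (Fin N) →ₗ[ℝ] ℝ)
    (V : Finset (EuclideanSpace ℝ (Fin N))) (w : EuclideanSpace ℝ (Fin N) → ℝ)
    (hw : ∑ y ∈ V, w y = 1) :
    φ (lift (∑ y ∈ V, w y • y)) = ∑ y ∈ V, w y * φ (lift y) := by
  have : lift (∑ y ∈ V, w y • y) = ∑ y ∈ V, w y • lift y := by
    ext1
    · simp [lift, Prod.fst_sum, hw]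
    · simp [lift, Prod.snd_sum]
  simp [this]

lemma map_lift_nonpos {V : Finset (EuclideanSpace ℝ (Fin N))}
    {φ : ℝ × EuclideanSpace ℝ (Fin N) →ₗ[ℝ] ℝ} (h : ∀ u ∈ V, φ (lift u) ≤ 0) :
    ∀ x ∈ convexHull ℝ (V : Set (EuclideanSpace ℝ (Fin N))), φ (lift x) ≤ 0 := by
  intro x hx
  obtain ⟨w, hw0, hw1, rfl⟩ := Finset.mem_convexHull'.1 hx
  rw [map_lift_sum φ V w hw1]
  exact Finset.sum_nonpos fun y hy => mul_nonpos_of_nonneg_of_nonpos (hw0 y hy) (h y hy)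

/-- A face of a polytope is spanned by the generating points it contains. -/
lemma IsFace.eq_convexHull {V : Finset (EuclideanSpace ℝ (Fin N))}
    {F : Set (EuclideanSpace ℝ (Fin N))} (h : IsFace (convexHull ℝ (V : Set _)) F) :
    F = convexHull ℝ (V ∩ F) := by
  classical
  obtain ⟨φ, hφ, rfl⟩ := isFace_iff.1 h
  apply Set.Subset.antisymm
  · rintro x ⟨hx, hx0⟩
    obtain ⟨w, hw0, hw1, rfl⟩ := Finset.mem_convexHull'.1 hx
    rw [map_lift_sum φ V w hw1, Finset.sum_eq_zero_iff_of_nonpos fun y hy =>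
      mul_nonpos_of_nonneg_of_nonpos (hw0 y hy) (hφ y (subset_convexHull ℝ _ hy))] at hx0
    have hzero : ∀ y ∈ V, w y ≠ 0 → φ (lift y) = 0 := fun y hy hwy =>
      (mul_eq_zero.1 (hx0 y hy)).resolve_left hwy
    have hmem : ∑ y ∈ V with φ (lift y) = 0, w y • y ∈
        convexHull ℝ ((V.filter fun y => φ (lift y) = 0 : Finset _) : Set _) := by
      refine Finset.mem_convexHull'.2 ⟨w, fun y hy => hw0 y (Finset.mem_filter.1 hy).1, ?_, rfl⟩
      rw [← hw1]
      exact Finset.sum_filter_of_ne hzero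
    rw [Finset.sum_filter_of_ne fun y hy hne => hzero y hy fun h0 => hne (by simp [h0])] at hmem
    refine convexHull_mono ?_ hmem
    intro y hy
    rw [Finset.mem_coe, Finset.mem_filter] at hy
    exact ⟨hy.1, subset_convexHull ℝ _ hy.1, hy.2⟩
  · obtain ⟨f, c, -, hF⟩ := h
    refine convexHull_min Set.inter_subset_right ?_
    rw [hF]
    exact (convex_convexHull ℝ _).inter (convex_hyperplane f.isLinear c)

lemma IsFace.isPolytope {P F : Set (EuclideanSpace ℝ (Fin N))} (hP : IsPolytope P)
    (h : IsFace P F) : IsPolytope F := by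
  classical
  obtain ⟨V, rfl⟩ := hP
  exact ⟨V.filter (· ∈ F), by rw [h.eq_convexHull]; congr 1; ext x; simp [← h.eq_convexHull]⟩

lemma IsPolytope.finite_faces {P : Set (EuclideanSpace ℝ (Fin N))} (hP : IsPolytope P) :
    {F | IsFace P F}.Finite := by
  obtain ⟨V, rfl⟩ := hP
  refine ((V.finite_toSet.finite_subsets).image fun A => convexHull ℝ A).subset ?_
  exact fun F hF => ⟨V ∩ F, Set.inter_subset_left, (IsFace.eq_convexHull hF).symm⟩

lemma IsFace.trans {P G H : Set (EuclideanSpace ℝ (Fin N))} (hP : IsPolytope P)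
    (hG : IsFace P G) (hH : IsFace G H) : IsFace P H := by
  obtain ⟨V, rfl⟩ := hP
  obtain ⟨φ, hφ, hGφ⟩ := isFace_iff.1 hG
  obtain ⟨ψ, hψ, hHψ⟩ := isFace_iff.1 hH
  obtain ⟨M, hM⟩ : ∃ M : ℝ, ∀ u ∈ V, φ (lift u) < 0 → ψ (lift u) + M * φ (lift u) < 0 := by
    have : ∀ᶠ M : ℝ in Filter.atTop, ∀ u ∈ V, φ (lift u) < 0 →
        ψ (lift u) + M * φ (lift u) < 0 := by
      rw [Filter.eventually_all_finset]
      intro u _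
      filter_upwards [Filter.eventually_gt_atTop (ψ (lift u) / -φ (lift u))] with M hM hu
      rw [div_lt_iff₀ (by linarith)] at hM
      linarith
    exact this.exists
  have hVG : ∀ u ∈ V, φ (lift u) = 0 → u ∈ G := fun u hu h => by
    rw [hGφ]
    exact ⟨subset_convexHull ℝ _ hu, h⟩
  have hχ : ∀ u ∈ V, (ψ + M • φ) (lift u) ≤ 0 := by
    intro u hu
    simp only [LinearMap.add_apply, LinearMap.smul_apply, smul_eq_mul]
    rcases (hφ u (subset_convexHull ℝ _ hu)).lt_or_eq with h | h
    · exact (hM u hu h).le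
    · simpa [h] using hψ u (hVG u hu h)
  have hface : IsFace (convexHull ℝ (V : Set _))
      {x ∈ convexHull ℝ (V : Set _) | (ψ + M • φ) (lift x) = 0} :=
    isFace_iff.2 ⟨_, map_lift_nonpos hχ, rfl⟩
  convert hface using 1
  apply Set.Subset.antisymm
  · intro x hx
    have hxG := hH.subset hx
    rw [hHψ] at hx
    have h1 := hx.2
    rw [hGφ] at hxG
    exact ⟨hxG.1, by simp [h1, hxG.2]⟩
  · have hconv : Convex ℝ H := by
      obtain ⟨W, hW⟩ := IsFace.isPolytope (hG.isPolytope ⟨V, rfl⟩) hH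
      rw [hW]
      exact convex_convexHull ℝ _
    rw [hface.eq_convexHull]
    refine convexHull_min ?_ hconv
    rintro u ⟨hu, -, hu0⟩
    simp only [LinearMap.add_apply, LinearMap.smul_apply, smul_eq_mul] at hu0
    rcases (hφ u (subset_convexHull ℝ _ hu)).lt_or_eq with h | h
    · exact absurd hu0 (hM u hu h).ne
    · rw [hHψ]
      exact ⟨hVG u hu h, by simpa [h] using hu0⟩

lemma coneRank_mono {F G : Set (EuclideanSpace ℝ (Fin N))} (h : F ⊆ G) :
    coneRank F ≤ coneRank G :=
  Submodule.finrank_mono (Submodule.span_mono (Set.image_mono h))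

lemma IsFace.coneRank_lt {P F G : Set (EuclideanSpace ℝ (Fin N))} (hF : IsFace P F)
    (hG : G ⊆ P) (hFG : F ⊂ G) : coneRank F < coneRank G := by
  refine (coneRank_mono hFG.1).lt_of_ne fun heq => hFG.2 ?_
  have hspan := Submodule.eq_of_le_of_finrank_eq
    (Submodule.span_mono (Set.image_mono hFG.1) :
      Submodule.span ℝ (lift '' F) ≤ Submodule.span ℝ (lift '' G)) heq
  obtain ⟨φ, -, hφ⟩ := isFace_iff.1 hF
  have hker : Submodule.span ℝ (lift '' F) ≤ LinearMap.ker φ := by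
    rw [Submodule.span_le]
    rintro _ ⟨x, hx, rfl⟩
    rw [hφ] at hx
    exact hx.2
  intro x hx
  rw [hφ]
  refine ⟨hG hx, hker ?_⟩
  rw [hspan]
  exact Submodule.subset_span ⟨x, hx, rfl⟩

open Classical in
/-- A linear functional that vanishes on a given subspace and is positive somewhere on the
generating set of a polytope whose cone has larger dimension. -/
lemma exists_pos_of_finrank_lt {V : Finset (EuclideanSpace ℝ (Fin N))}
    {S : Submodule ℝ (ℝ × EuclideanSpace ℝ (Fin N))}
    (h : Module.finrank ℝ S < coneRank (convexHull ℝ (V : Set (EuclideanSpace ℝ (Fin N))))) :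
    ∃ ψ : ℝ × EuclideanSpace ℝ (Fin N) →ₗ[ℝ] ℝ,
      (V.filter fun u => 0 < ψ (lift u)).Nonempty ∧ S ≤ LinearMap.ker ψ := by
  obtain ⟨p, hp, hpS⟩ :
      ∃ p ∈ convexHull ℝ (V : Set (EuclideanSpace ℝ (Fin N))), lift p ∉ S := by
    by_contra! hcon
    refine absurd (Submodule.finrank_mono (Submodule.span_le.2 ?_)) (not_le.2 h)
    rintro _ ⟨x, hx, rfl⟩
    exact hcon x hx
  obtain ⟨ψ, hψp, hψS⟩ : ∃ ψ : ℝ × EuclideanSpace ℝ (Fin N) →ₗ[ℝ] ℝ,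
      0 < ψ (lift p) ∧ S ≤ LinearMap.ker ψ := by
    obtain ⟨ψ, h1, h2⟩ := Submodule.exists_le_ker_of_notMem hpS
    rcases lt_or_gt_of_ne h1 with h | h
    · exact ⟨-ψ, by simpa using h, fun x hx => by simpa using h2 hx⟩
    · exact ⟨ψ, h, h2⟩
  refine ⟨ψ, ?_, hψS⟩
  by_contra hcon
  rw [Finset.not_nonempty_iff_eq_empty, Finset.filter_eq_empty_iff] at hcon
  exact absurd hψp (not_lt.2 (map_lift_nonpos (fun u hu => not_lt.1 (hcon hu)) p hp))

/-- Rotating a supporting hyperplane around a face of corank at least two and a point `w` off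
it produces a larger face that still misses `w`. -/
lemma IsFace.exists_ssuperset {P F : Set (EuclideanSpace ℝ (Fin N))} (hP : IsPolytope P)
    (hF : IsFace P F) {w : EuclideanSpace ℝ (Fin N)} (hw : w ∈ P) (hwF : w ∉ F)
    (hrk : coneRank F + 1 < coneRank P) : ∃ G, IsFace P G ∧ F ⊂ G ∧ w ∉ G := by
  classical
  obtain ⟨V, rfl⟩ := hP
  obtain ⟨φ, hφ, hFφ⟩ := isFace_iff.1 hF
  obtain ⟨ψ, hA, hψS⟩ := exists_pos_of_finrank_lt
    (S := Submodule.span ℝ (lift '' F) ⊔ Submodule.span ℝ {lift w})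
    (((Submodule.finrank_add_le_finrank_add_finrank _ _).trans
      (by rw [finrank_span_singleton (by simp [lift])]; rfl)).trans_lt hrk)
  have hψF : ∀ x ∈ F, ψ (lift x) = 0 := fun x hx =>
    hψS (Submodule.mem_sup_left (Submodule.subset_span ⟨x, hx, rfl⟩))
  have hψw : ψ (lift w) = 0 :=
    hψS (Submodule.mem_sup_right (Submodule.mem_span_singleton_self _))
  obtain ⟨u, hu, hmin⟩ := Finset.exists_min_image
    (V.filter fun u => 0 < ψ (lift u)) (fun u => -φ (lift u) / ψ (lift u)) hA
  set t := -φ (lift u) / ψ (lift u) with ht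
  rw [Finset.mem_filter] at hu
  have huP : u ∈ convexHull ℝ (V : Set _) := subset_convexHull ℝ _ hu.1
  have ht0 : 0 ≤ t := div_nonneg (by linarith [hφ u huP]) hu.2.le
  have hχu : φ (lift u) + t * ψ (lift u) = 0 := by
    rw [ht, div_mul_cancel₀ _ hu.2.ne']
    ring
  have hχ : ∀ x ∈ V, (φ + t • ψ) (lift x) ≤ 0 := by
    intro x hx
    simp only [LinearMap.add_apply, LinearMap.smul_apply, smul_eq_mul]
    by_cases hxA : 0 < ψ (lift x)
    · have h1 := hmin x (Finset.mem_filter.2 ⟨hx, hxA⟩)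
      rw [le_div_iff₀ hxA] at h1
      linarith
    · have h1 := hφ x (subset_convexHull ℝ _ hx)
      have h2 := mul_nonpos_of_nonneg_of_nonpos ht0 (not_lt.1 hxA)
      linarith
  refine ⟨_, isFace_iff.2 ⟨_, map_lift_nonpos hχ, rfl⟩, ⟨fun x hx => ?_, fun hsub => ?_⟩, ?_⟩
  · have h1 := hψF x hx
    rw [hFφ] at hx
    exact ⟨hx.1, by simp [h1, hx.2]⟩
  · exact hu.2.ne' (hψF u (hsub ⟨huP, by simpa using hχu⟩))
  · rintro ⟨-, h⟩
    refine hwF ?_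
    rw [hFφ]
    exact ⟨hw, by simpa [hψw] using h⟩

/-- A proper face and a point off it are separated by a facet. -/
lemma IsFace.exists_facet {P F : Set (EuclideanSpace ℝ (Fin N))} (hP : IsPolytope P)
    (hF : IsFace P F) {w : EuclideanSpace ℝ (Fin N)} (hw : w ∈ P) (hwF : w ∉ F) :
    ∃ G, IsFace P G ∧ F ⊆ G ∧ w ∉ G ∧ coneRank G + 1 = coneRank P := by
  induction hn : coneRank P - coneRank F using Nat.strong_induction_on generalizing F with
  | _ n ih =>
    have hlt := hF.coneRank_lt subset_rfl ⟨hF.subset, fun h => hwF (h hw)⟩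
    by_cases h1 : coneRank F + 1 = coneRank P
    · exact ⟨F, hF, subset_rfl, hwF, h1⟩
    obtain ⟨G, hG, hFG, hwG⟩ := hF.exists_ssuperset hP hw hwF (by omega)
    have h2 := hF.coneRank_lt hG.subset hFG
    obtain ⟨H, h3, h4, h5, h6⟩ := ih (coneRank P - coneRank G) (by omega) hG hwG rfl
    exact ⟨H, h3, hFG.1.trans h4, h5, h6⟩

instance (P : Set (EuclideanSpace ℝ (Fin N))) : SemilatticeInf {F // IsFace P F} :=
  Subtype.semilatticeInf fun _ _ => IsFace.inter

instance (P : Set (EuclideanSpace ℝ (Fin N))) : OrderBot {F // IsFace P F} :=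
  Subtype.orderBot (IsFace.empty P)

lemma isFaceRank_coneRank {P : Set (EuclideanSpace ℝ (Fin N))} (hP : IsPolytope P) :
    IsFaceRank fun F : {F // IsFace P F} => coneRank F.1 where
  strictMono F G h := F.2.coneRank_lt G.2.subset h
  exists_separating := by
    rintro ⟨F, hF⟩ ⟨G, hG⟩ ⟨W, hW⟩ hFG hWG hWF
    obtain ⟨w, hw, hwF⟩ := Set.not_subset.1 hWF
    obtain ⟨H, h1, h2, h3, h4⟩ :=
      (hF.of_subset hFG hG.subset).exists_facet (hG.isPolytope hP) (hWG hw) hwF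
    exact ⟨⟨H, hG.trans hP h1⟩, h2, h1.subset, fun h => h3 (h hw), h4⟩

variable {P : Set (EuclideanSpace ℝ (Fin N))} [Fintype {F // IsFace P F}]

lemma card_level_coneRank (A B : {F // IsFace P F}) (j : ℕ) :
    (level (fun F : {F // IsFace P F} => coneRank F.1) A B j).card =
      {F | IsFace P F ∧ A.1 ⊆ F ∧ F ⊆ B.1 ∧ coneRank F = j}.ncard := by
  rw [← Set.ncard_coe_finset, ← Set.ncard_image_of_injective _ Subtype.val_injective]
  congr 1
  ext F
  simp only [Set.mem_image, Finset.mem_coe, mem_level, Set.mem_ofPred_eq]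
  constructor
  · rintro ⟨G, ⟨h1, h2, h3⟩, rfl⟩
    exact ⟨G.2, h1, h2, h3⟩
  · rintro ⟨h, h1, h2, h3⟩
    exact ⟨⟨F, h⟩, ⟨h1, h2, h3⟩, rfl⟩

lemma card_level_one (B : {F // IsFace P F}) :
    (level (fun F : {F // IsFace P F} => coneRank F.1) ⊥ B 1).card =
      {v ∈ vertexSet P | v ∈ B.1}.ncard := by
  rw [card_level_coneRank, ← Set.ncard_image_of_injective {v ∈ vertexSet P | v ∈ B.1}
    Set.singleton_injective]
  congr 1
  ext F
  simp only [Set.mem_image, Set.mem_ofPred_eq, coneRank_eq_one_iff, vertexSet]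
  constructor
  · rintro ⟨h, -, h1, v, rfl⟩
    exact ⟨v, ⟨h, by simpa using h1⟩, rfl⟩
  · rintro ⟨v, ⟨h, h1⟩, rfl⟩
    exact ⟨h, Set.empty_subset _, by simpa using h1, v, rfl⟩

end Polytope

theorem stmt19 {N : ℕ} (P : Set (EuclideanSpace ℝ (Fin N))) (d s k : ℕ)
    (hP : IsPolytope P) (hdim : pdim P = d)
    (hvert : (vertexSet P).ncard = d + s)
    (hs : 2 ≤ s) (hsd : s ≤ d) (hk1 : 1 ≤ k) (hk2 : k ≤ d - 2)
    (heq : (fCount P k : ℤ) = phi d s k)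
    (Q : Set (EuclideanSpace ℝ (Fin N)))
    (hQ : IsFace P Q) (hQne : Q.Nonempty) (hQdim : pdim Q = d - 1)
    (hQvert : (vertexSet Q).ncard ≤ d + s - 2) :
    ∀ v ∈ vertexSet P, v ∉ Q →
      {F : Set (EuclideanSpace ℝ (Fin N)) |
        IsFace P F ∧ F.Nonempty ∧ pdim F = d - 1 ∧ v ∈ F}.ncard = d := by
  intro v hv hvQ
  have : Fintype {F // IsFace P F} := hP.finite_faces.fintype
  have hcard : ∀ A B : {F // IsFace P F}, ∀ j,
      (level (fun F : {F // IsFace P F} => coneRank F.1) A B (j + 1)).card =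
        {F | IsFace P F ∧ A.1 ⊆ F ∧ F ⊆ B.1 ∧ F.Nonempty ∧ pdim F = j}.ncard := fun A B j => by
    simp only [card_level_coneRank, coneRank_eq_add_one_iff]
  have hfin : (vertexSet Q).Finite :=
    ((hQ.isPolytope hP).finite_faces.preimage Set.singleton_injective.injOn :)
  have h1 := (isFaceRank_coneRank hP).card_coatoms_of_card_level_eq_phi
    (b := ⟨P, IsFace.refl P⟩) (F := ⟨Q, hQ⟩) (v := ⟨{v}, hv⟩) (d := d) (s := s) (k := k)
    coneRank_empty
    (by rw [coneRank_eq_pdim_add_one (hQne.mono hQ.subset), hdim]) hs hsd hk1 (by omega)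
    (by
      rw [card_level_one, ← hvert]
      congr 1
      ext x
      simp only [Set.mem_ofPred_eq, and_iff_left_iff_imp]
      exact fun hx => hx.subset rfl)
    (by
      rw [← heq, hcard, fCount]
      congr 2
      ext F
      simp only [Set.mem_ofPred_eq]
      exact ⟨fun h => ⟨h.1, h.2.2.2⟩, fun h => ⟨h.1, Set.empty_subset _, h.1.subset, h.2⟩⟩)
    hQ.subset
    (by rw [coneRank_eq_pdim_add_one hQne, hQdim]; omega)
    (by
      rw [card_level_one]
      refine le_trans (Set.ncard_le_ncard ?_ hfin) hQvert
      rintro x ⟨hx, hxQ⟩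
      exact IsFace.of_subset hx (by simpa using hxQ) hQ.subset)
    (mem_level.2 ⟨bot_le, IsFace.subset hv, coneRank_eq_one_iff.2 ⟨v, rfl⟩⟩)
    (fun h => hvQ (h rfl))
  obtain ⟨e, rfl⟩ : ∃ e, d = e + 1 := ⟨d - 1, by omega⟩
  rw [hcard] at h1
  refine Eq.trans (congrArg Set.ncard ?_) h1
  ext F
  simp only [Set.mem_ofPred_eq, Set.singleton_subset_iff, Nat.add_sub_cancel]
  exact ⟨fun h => ⟨h.1, h.2.2.2, h.1.subset, h.2.1, h.2.2.1⟩,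
    fun h => ⟨h.1, h.2.2.2.1, h.2.2.2.2, h.2.1⟩⟩
end
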